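/- Let c = c_n be the n-cycle s_{n−1}⋯s_2s_1, ζ = e^{2πi/n}, and f⁺ = (1/n) ∑_{k=0}^{n−1} ζ^{−k} c^{−k} ∈ ℂW. Then the map f⁺ℂW → E_n, x ↦ e_n x, is an isomorphism of right ℂW-modules. Consequently, the character of W = S_n acting on E_n = e_n ℂW by right multiplication equals the induced character Ind_{Z_W(c)}^W(φ), where Z_W(c) = ⟨c⟩ is the centralizer of c in W and φ : ⟨c⟩ → ℂˣ is the linear character with φ(c⁻¹) = ζ. -/

import Mathlib

open scoped Classical
open MonoidAlgebra Finset Equiv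

noncomputable section

namespace DPRSym

variable (n : ℕ)

/-- The simple reflection `s_i` (1-based, `1 ≤ i ≤ n-1`) of the symmetric group
`S_n = Perm (Fin n)`: the transposition of the (0-based) points `i-1` and `i`. -/
def sgen (i : ℕ) : Equiv.Perm (Fin n) :=
  if h : 0 < i ∧ i < n then Equiv.swap ⟨i - 1, by omega⟩ ⟨i, h.2⟩ else 1

/-- The Coxeter generating set `S = {s_1, …, s_{n-1}}` of `S_n`. -/
def Simples : Finset (Equiv.Perm (Fin n)) := (Finset.Icc 1 (n - 1)).image (sgen n)

/-- The Coxeter length of a permutation: the length of a shortest word in the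
generators `S` expressing it. -/
def len (w : Equiv.Perm (Fin n)) : ℕ :=
  sInf {k | ∃ L : List (Equiv.Perm (Fin n)),
    (∀ x ∈ L, x ∈ Simples n) ∧ L.length = k ∧ L.prod = w}

/-- The `i`-cycle `c_i = s_{i-1} ⋯ s_2 s_1` (with `c_1 = 1`). -/
def cgen (i : ℕ) : Equiv.Perm (Fin n) :=
  (((List.range (i - 1)).reverse).map (fun j => sgen n (j + 1))).prod

/-- The set `W^I` of minimal length left coset representatives of `W_I`,
computed inside the subset `H` (take `H = Set.univ` for the absolute case). -/
def minCoset (H : Set (Equiv.Perm (Fin n))) (I : Finset (Equiv.Perm (Fin n))) :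
    Finset (Equiv.Perm (Fin n)) :=
  Finset.univ.filter (fun w => w ∈ H ∧ ∀ s ∈ I, len n w < len n (w * s))

/-- The element `x_I = ∑_{w ∈ W^I} w` of the group algebra. -/
def xRel (H : Set (Equiv.Perm (Fin n))) (I : Finset (Equiv.Perm (Fin n))) :
    MonoidAlgebra ℂ (Equiv.Perm (Fin n)) :=
  ∑ w ∈ minCoset n H I, of ℂ (Equiv.Perm (Fin n)) w

/-- `w(Δ_J) ⊆ Δ_D`: for every `s ∈ J`, `wsw⁻¹ ∈ D` and `ℓ(ws) = ℓ(w) + 1`. -/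
def Takes (D : Finset (Equiv.Perm (Fin n))) (w : Equiv.Perm (Fin n))
    (J : Finset (Equiv.Perm (Fin n))) : Prop :=
  ∀ s ∈ J, w * s * w⁻¹ ∈ D ∧ len n (w * s) = len n w + 1

/-- `ᵂJ = wJw⁻¹`. -/
def conjF (w : Equiv.Perm (Fin n)) (J : Finset (Equiv.Perm (Fin n))) :
    Finset (Equiv.Perm (Fin n)) :=
  J.image (fun s => w * s * w⁻¹)

/-- The coefficient `m_{JK}` (for `σ ≡ 1`: the number of `w ∈ W^K` with
`w(Δ_J) ⊆ Δ`), relative to the pair `(H, D)`. -/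
def mC (H : Set (Equiv.Perm (Fin n))) (D : Finset (Equiv.Perm (Fin n)))
    (J K : Finset (Equiv.Perm (Fin n))) : ℕ :=
  if J ⊆ K then ((minCoset n H K).filter (fun w => Takes n D w J)).card else 0

/-- The family `(e_J)` of BBHT quasi-idempotents for `σ ≡ 1`, relative to `(H, D)`:
the unique solution of the triangular system `x_K = ∑_{J ⊆ K} m_{JK} e_J`, `K ⊆ D`. -/
def IsBBHT (H : Set (Equiv.Perm (Fin n))) (D : Finset (Equiv.Perm (Fin n)))
    (e : Finset (Equiv.Perm (Fin n)) → MonoidAlgebra ℂ (Equiv.Perm (Fin n))) : Prop :=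
  ∀ K ∈ D.powerset, xRel n H K = ∑ J ∈ K.powerset, (mC n H D J K : ℂ) • e J

/-- `b⁺(m, k)`: the coefficient of `t^k` in `(1 - c_1 t)(1 - c_2 t) ⋯ (1 - c_m t)`,
a polynomial with coefficients in the group algebra `ℂ S_n`. -/
def bplus (m k : ℕ) : MonoidAlgebra ℂ (Equiv.Perm (Fin n)) :=
  (((List.range m).map (fun i =>
      1 - Polynomial.C (of ℂ (Equiv.Perm (Fin n)) (cgen n (i + 1))) * Polynomial.X)).prod).coeff k

/-- The transposition of the 0-based points `a` and `b` (junk value `1` if out of range). -/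
def fswap (a b : ℕ) : Equiv.Perm (Fin n) :=
  if h : a < n ∧ b < n then Equiv.swap ⟨a, h.1⟩ ⟨b, h.2⟩ else 1

section

variable {n : ℕ}

lemma mem_Simples {g : Perm (Fin n)} :
    g ∈ Simples n ↔ ∃ x y : Fin n, (x : ℕ) + 1 = y ∧ g = swap x y := by
  simp only [Simples, mem_image, mem_Icc]
  constructor
  · rintro ⟨i, hi, rfl⟩
    have h : 0 < i ∧ i < n := by omega
    refine ⟨⟨i - 1, by omega⟩, ⟨i, h.2⟩, ?_, ?_⟩
    · simp; omega
    · simp [sgen, h]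
  · rintro ⟨x, y, hxy, rfl⟩
    have := y.2
    refine ⟨y, by omega, ?_⟩
    have h : 0 < (y : ℕ) ∧ (y : ℕ) < n := by omega
    rw [sgen, dif_pos h]
    congr 1
    ext; simp; omega

/-- The set of inversions of a permutation. -/
def inversions (w : Perm (Fin n)) : Finset (Fin n × Fin n) :=
  univ.filter fun p => p.1 < p.2 ∧ w p.2 < w p.1

lemma mem_inversions {w : Perm (Fin n)} {a b : Fin n} :
    (a, b) ∈ inversions w ↔ a < b ∧ w b < w a := by
  simp [inversions]

lemma card_inversions_mul_swap {w : Perm (Fin n)} {x y : Fin n} (hxy : (x : ℕ) + 1 = y)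
    (h : w x < w y) : (inversions (w * swap x y)).card = (inversions w).card + 1 := by
  have hne : x ≠ y := by rintro rfl; omega
  have key : inversions (w * swap x y) = insert (x, y)
      ((inversions w).map ((swap x y).prodCongr (swap x y)).toEmbedding) := by
    ext ⟨a, b⟩
    rw [mem_insert, mem_map_equiv, mem_inversions]
    change _ ↔ _ ∨ (swap x y a, swap x y b) ∈ inversions w
    rw [mem_inversions, Prod.mk.injEq, Perm.mul_apply, Perm.mul_apply]
    by_cases hab : a = x ∧ b = y
    · obtain ⟨rfl, rfl⟩ := hab
      have : a < b := by rw [Fin.lt_def]; omega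
      simp [h, this]
    · have key : swap x y a < swap x y b ∨ (a = y ∧ b = x) ↔ a < b ∨ (a = y ∧ b = x) := by
        simp only [swap_apply_def, Fin.lt_def, Fin.ext_iff] at *
        split_ifs <;> omega
      by_cases hba : a = y ∧ b = x
      · obtain ⟨rfl, rfl⟩ := hba
        have : b < a := by rw [Fin.lt_def]; omega
        simp [Ne.symm hne, h.le]
      · tauto
  rw [key, card_insert_of_notMem, card_map]
  rw [mem_map_equiv]
  change (swap x y x, swap x y y) ∉ _
  rw [mem_inversions, swap_apply_left, swap_apply_right, Fin.lt_def]
  omega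

lemma card_inversions_mul_swap_of_gt {w : Perm (Fin n)} {x y : Fin n} (hxy : (x : ℕ) + 1 = y)
    (h : w y < w x) : (inversions (w * swap x y)).card + 1 = (inversions w).card := by
  rw [← card_inversions_mul_swap hxy (by simpa using h), mul_assoc, swap_mul_self, mul_one]

lemma strictMono_of_adjacent {α : Type*} [Preorder α] {f : Fin n → α}
    (h : ∀ x y : Fin n, (x : ℕ) + 1 = y → f x < f y) : StrictMono f := by
  cases n with
  | zero => exact fun x => x.elim0
  | succ n => exact Fin.strictMono_iff_lt_succ.2 fun i => h _ _ (by simp)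

lemma monotone_of_adjacent {α : Type*} [Preorder α] {f : Fin n → α}
    (h : ∀ x y : Fin n, (x : ℕ) + 1 = y → f x ≤ f y) : Monotone f := by
  cases n with
  | zero => exact fun x => x.elim0
  | succ n => exact Fin.monotone_iff_le_succ.2 fun i => h _ _ (by simp)

lemma perm_eq_one_of_adjacent {w : Perm (Fin n)}
    (h : ∀ x y : Fin n, (x : ℕ) + 1 = y → w x < w y) : w = 1 :=
  (Perm.monotone_iff w).1 (strictMono_of_adjacent h).monotone

lemma card_inversions_le_length (L : List (Perm (Fin n))) (hL : ∀ x ∈ L, x ∈ Simples n) :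
    (inversions L.prod).card ≤ L.length := by
  induction L using List.reverseRecOn with
  | nil =>
    simp only [List.prod_nil, List.length_nil, nonpos_iff_eq_zero, card_eq_zero]
    ext ⟨a, b⟩
    simpa [mem_inversions] using fun h : a < b => h.le
  | append_singleton L s ih =>
    obtain ⟨x, y, hxy, rfl⟩ := mem_Simples.1 (hL s (by simp))
    have := ih fun z hz => hL z (by simp [hz])
    rw [List.prod_append, List.prod_singleton, List.length_append, List.length_singleton]
    rcases lt_trichotomy (L.prod x) (L.prod y) with h | h | h
    · rw [card_inversions_mul_swap hxy h]; omega
    · have := L.prod.injective h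
      simp [this] at hxy
    · have := card_inversions_mul_swap_of_gt hxy h; omega

lemma exists_word (k : ℕ) : ∀ w : Perm (Fin n), (inversions w).card = k →
    ∃ L : List (Perm (Fin n)), (∀ x ∈ L, x ∈ Simples n) ∧ L.length = k ∧ L.prod = w := by
  induction k with
  | zero =>
    intro w hw
    refine ⟨[], by simp, rfl, (perm_eq_one_of_adjacent fun x y hxy => ?_).symm⟩
    by_contra h
    have hne : w y ≠ w x := fun h' => by simp [w.injective h'] at hxy
    have := card_inversions_mul_swap_of_gt hxy (lt_of_le_of_ne (not_lt.1 h) hne)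
    omega
  | succ k ih =>
    intro w hw
    have : ∃ x y : Fin n, (x : ℕ) + 1 = y ∧ w y < w x := by
      by_contra! H
      have : w = 1 := perm_eq_one_of_adjacent fun x y hxy =>
        lt_of_le_of_ne (H x y hxy) fun h' => by simp [w.injective h'] at hxy
      subst this
      have := card_inversions_le_length (n := n) [] (by simp)
      simp at this
      simp [this] at hw
    obtain ⟨x, y, hxy, h⟩ := this
    obtain ⟨L, hL, hk, hp⟩ := ih (w * swap x y)
      (by have := card_inversions_mul_swap_of_gt hxy h; omega)
    refine ⟨L ++ [swap x y], ?_, by simp [hk], by simp [hp, mul_assoc]⟩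
    simp only [List.mem_append, List.mem_singleton]
    rintro z (hz | rfl)
    · exact hL z hz
    · exact mem_Simples.2 ⟨x, y, hxy, rfl⟩

lemma len_eq_card_inversions (w : Perm (Fin n)) : len n w = (inversions w).card := by
  apply le_antisymm
  · exact Nat.sInf_le (exists_word _ w rfl)
  · refine le_csInf ⟨_, exists_word _ w rfl⟩ ?_
    rintro k ⟨L, hL, rfl, rfl⟩
    exact card_inversions_le_length L hL

lemma len_lt_len_mul_swap {w : Perm (Fin n)} {x y : Fin n} (hxy : (x : ℕ) + 1 = y) :
    len n w < len n (w * swap x y) ↔ w x < w y := by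
  rw [len_eq_card_inversions, len_eq_card_inversions]
  rcases lt_trichotomy (w x) (w y) with h | h | h
  · rw [card_inversions_mul_swap hxy h]; simp [h]
  · simp [w.injective h] at hxy
  · have := card_inversions_mul_swap_of_gt hxy h
    simp only [not_lt.2 h.le, iff_false]; omega

lemma len_mul_swap_eq {w : Perm (Fin n)} {x y : Fin n} (hxy : (x : ℕ) + 1 = y) :
    len n (w * swap x y) = len n w + 1 ↔ w x < w y := by
  rw [len_eq_card_inversions, len_eq_card_inversions]
  rcases lt_trichotomy (w x) (w y) with h | h | h
  · rw [card_inversions_mul_swap hxy h]; simp [h]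
  · simp [w.injective h] at hxy
  · have := card_inversions_mul_swap_of_gt hxy h
    simp only [not_lt.2 h.le, iff_false]; omega

lemma mem_minCoset {w : Perm (Fin n)} {K : Finset (Perm (Fin n))} (hK : K ⊆ Simples n) :
    w ∈ minCoset n Set.univ K ↔
      ∀ x y : Fin n, (x : ℕ) + 1 = y → swap x y ∈ K → w x < w y := by
  simp only [minCoset, mem_filter, mem_univ, Set.mem_univ, true_and]
  constructor
  · exact fun h x y hxy hs => (len_lt_len_mul_swap hxy).1 (h _ hs)
  · intro h s hs
    obtain ⟨x, y, hxy, rfl⟩ := mem_Simples.1 (hK hs)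
    exact (len_lt_len_mul_swap hxy).2 (h x y hxy hs)

lemma takes_iff {w : Perm (Fin n)} {J : Finset (Perm (Fin n))} (hJ : J ⊆ Simples n) :
    Takes n (Simples n) w J ↔
      ∀ x y : Fin n, (x : ℕ) + 1 = y → swap x y ∈ J → (w x : ℕ) + 1 = w y := by
  have conj (x y : Fin n) : w * swap x y * w⁻¹ = swap (w x) (w y) := by
    rw [swap_apply_apply]
  constructor
  · intro h x y hxy hs
    obtain ⟨h1, h2⟩ := h _ hs
    rw [len_mul_swap_eq hxy] at h2
    rw [conj, mem_Simples] at h1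
    obtain ⟨a, b, hab, he⟩ := h1
    have hne : w x ≠ w y := h2.ne
    have h3 := congrArg (fun f => f (w x)) he
    simp only [swap_apply_left, swap_apply_def] at h3
    have h4 := congrArg (fun f => f a) he
    simp only [swap_apply_left, swap_apply_def] at h4
    simp only [Fin.lt_def, Fin.ext_iff, ne_eq] at *
    split_ifs at * <;> omega
  · intro h s hs
    obtain ⟨x, y, hxy, rfl⟩ := mem_Simples.1 (hJ hs)
    have := h x y hxy hs
    exact ⟨by rw [conj]; exact mem_Simples.2 ⟨_, _, this, rfl⟩,
      (len_mul_swap_eq hxy).2 (by rw [Fin.lt_def]; omega)⟩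

/-- The polynomial `X (X - 1) ⋯ (X - r + 1) / r!`. -/
def choosePoly (r : ℕ) : Polynomial ℂ :=
  Polynomial.C ((r.factorial : ℂ)⁻¹) * descPochhammer ℂ r

lemma eval_choosePoly (r s : ℕ) : (choosePoly r).eval (s : ℂ) = s.choose r := by
  have : (r.factorial : ℂ) ≠ 0 := by exact_mod_cast r.factorial_ne_zero
  rw [choosePoly, Polynomial.eval_mul, Polynomial.eval_C,
    descPochhammer_eval_eq_descFactorial, Nat.descFactorial_eq_factorial_mul_choose]
  push_cast
  field_simp

/-- The coefficient of the linear term of `choosePoly r`. -/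
def linCoeff (r : ℕ) : ℂ := (choosePoly r).derivative.eval 0

lemma eval_neg_one_descPochhammer (r : ℕ) :
    (descPochhammer ℂ r).eval (-1) = (-1) ^ r * r.factorial := by
  induction r with
  | zero => simp
  | succ r ih =>
    rw [descPochhammer_succ_right, Polynomial.eval_mul, ih, Nat.factorial_succ]
    simp
    ring

lemma linCoeff_succ (r : ℕ) : linCoeff (r + 1) = (-1) ^ r / (r + 1) := by
  have h1 : (r.factorial : ℂ) ≠ 0 := by exact_mod_cast r.factorial_ne_zero
  have h2 : (r : ℂ) + 1 ≠ 0 := by exact_mod_cast r.succ_ne_zero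
  rw [linCoeff, choosePoly, descPochhammer_succ_left]
  simp only [Polynomial.derivative_mul, Polynomial.eval_mul,
    Polynomial.eval_C, Polynomial.derivative_X, Polynomial.eval_add, Polynomial.eval_X,
    Polynomial.eval_one, Polynomial.eval_comp, Polynomial.eval_sub]
  rw [zero_sub, eval_neg_one_descPochhammer, Nat.factorial_succ]
  push_cast
  field_simp
  ring

lemma eq_of_eval_natCast_eq {p q : Polynomial ℂ}
    (h : ∀ s : ℕ, p.eval (s : ℂ) = q.eval (s : ℂ)) : p = q := by
  apply Polynomial.eq_of_infinite_eval_eq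
  refine (Set.infinite_range_of_injective (Nat.cast_injective (R := ℂ))).mono ?_
  rintro _ ⟨s, rfl⟩
  exact h s

/-- The number of maps `ι → {0, …, s - 1}` with a property that only depends on the relative order
of the values is a polynomial in `s`. -/
lemma exists_polynomial_card {ι : Type*} [Fintype ι] [DecidableEq ι] [Nonempty ι]
    (R : (ι → ℕ) → Prop)
    (hR : ∀ a b : ι → ℕ, (∀ i j, a i < a j ↔ b i < b j) → R a → R b) :
    ∃ p : Polynomial ℂ, p.eval 0 = 0 ∧
      ∀ s : ℕ, p.eval (s : ℂ) = (univ.filter fun a : ι → Fin s => R fun i => a i).card := by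
  set r : ℕ → ℕ := fun j =>
    (univ.filter fun a : ι → Fin j => Function.Surjective a ∧ R fun i => a i).card with hr
  have key (s : ℕ) : (univ.filter fun a : ι → Fin s => R fun i => a i).card =
      ∑ j ∈ range (s + 1), s.choose j * r j := by
    have h := card_eq_sum_card_fiberwise (s := univ.filter fun a : ι → Fin s => R fun i => a i)
      (f := fun a => univ.image a) (t := (univ : Finset (Fin s)).powerset) (by simp)
    rw [h]
    trans ∑ T ∈ (univ : Finset (Fin s)).powerset, r T.card
    · refine sum_congr rfl fun T _ => ?_
      rw [hr]
      symm
      refine card_bij (fun a _ i => T.orderEmbOfFin rfl (a i)) ?_ ?_ ?_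
      · intro a ha
        simp only [mem_filter, mem_univ, true_and] at ha ⊢
        refine ⟨hR _ _ (fun i j => ?_) ha.2, ?_⟩
        · simp
        · ext t
          simp only [mem_image, mem_univ, true_and]
          have hT := Finset.range_orderEmbOfFin T rfl
          rw [← mem_coe, ← hT, Set.mem_range]
          constructor
          · rintro ⟨i, rfl⟩
            exact ⟨_, rfl⟩
          · rintro ⟨j, rfl⟩
            obtain ⟨i, rfl⟩ := ha.1 j
            exact ⟨i, rfl⟩
      · intro a _ b _ hab
        funext i
        exact (T.orderEmbOfFin rfl).injective (congrFun hab i)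
      · intro b hb
        simp only [mem_filter, mem_univ, true_and] at hb
        obtain ⟨hb, rfl⟩ := hb
        have hT := Finset.range_orderEmbOfFin (univ.image b) rfl
        have (i : ι) : ∃ j, (univ.image b).orderEmbOfFin rfl j = b i := by
          rw [← Set.mem_range, hT]; simp
        choose a ha using this
        refine ⟨a, ?_, funext ha⟩
        simp only [mem_filter, mem_univ, true_and]
        refine ⟨fun j => ?_, hR _ _ (fun i j => ?_) hb⟩
        · have : (univ.image b).orderEmbOfFin rfl j ∈ univ.image b := orderEmbOfFin_mem _ _ _
          simp only [mem_image, mem_univ, true_and] at this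
          obtain ⟨i, hi⟩ := this
          exact ⟨i, ((univ.image b).orderEmbOfFin rfl).injective (by rw [ha, hi])⟩
        · rw [← ha, ← ha]
          simp
    · rw [sum_powerset_apply_card]
      simp
  have hr0 (j : ℕ) (hj : Fintype.card ι < j) : r j = 0 := by
    rw [hr]
    simp only [card_eq_zero, filter_eq_empty_iff, mem_univ, true_implies]
    rintro a ⟨h, -⟩
    have := Fintype.card_le_of_surjective a h
    simp at this
    omega
  have hp (s : ℕ) : (∑ j ∈ range (Fintype.card ι + 1),
      choosePoly j * Polynomial.C (r j : ℂ)).eval (s : ℂ) =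
      (univ.filter fun a : ι → Fin s => R fun i => a i).card := by
    rw [key, Polynomial.eval_finsetSum]
    push_cast
    simp only [Polynomial.eval_mul, eval_choosePoly, Polynomial.eval_C]
    trans ∑ j ∈ range (Fintype.card ι + s + 1), (s.choose j : ℂ) * r j
    · refine sum_subset (range_mono (by omega)) fun j _ hj => ?_
      rw [hr0 j (by simpa using hj)]; simp
    · symm
      refine sum_subset (range_mono (by omega)) fun j _ hj => ?_
      rw [Nat.choose_eq_zero_of_lt (by simpa using hj)]; simp
  refine ⟨_, ?_, hp⟩
  have := hp 0
  rw [Nat.cast_zero] at this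
  rw [this, Nat.cast_eq_zero, card_eq_zero, filter_eq_empty_iff]
  exact fun a _ => (a (Classical.arbitrary ι)).elim0

lemma swap_adjacent_inj {x y x' y' : Fin n} (h : (x : ℕ) + 1 = y) (h' : (x' : ℕ) + 1 = y')
    (he : swap x y = swap x' y') : x = x' ∧ y = y' := by
  have h1 := congrArg (fun f => f x) he
  have h2 := congrArg (fun f => f x') he
  simp only [swap_apply_left, swap_apply_def, Fin.ext_iff] at *
  split_ifs at * <;> omega

lemma exists_blockMap (hn : 0 < n) {K : Finset (Perm (Fin n))} (hK : K ⊆ Simples n) :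
    ∃ m, m + K.card = n ∧ ∃ β : Fin n → Fin m, Monotone β ∧ Function.Surjective β ∧
      ∀ x y : Fin n, (x : ℕ) + 1 = y →
        (swap x y ∈ K → β x = β y) ∧ (swap x y ∉ K → (β x : ℕ) + 1 = β y) := by
  obtain ⟨N, rfl⟩ : ∃ N, n = N + 1 := ⟨n - 1, by omega⟩
  set f : ℕ → ℕ := fun i => ((range i).filter fun j => sgen (N + 1) (j + 1) ∉ K).card with hf
  have hmono : Monotone f := fun i j h => card_le_card (filter_subset_filter _ (range_mono h))
  have hsucc (i : ℕ) : f (i + 1) = f i + if sgen (N + 1) (i + 1) ∈ K then 0 else 1 := by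
    simp only [hf]
    rw [range_add_one, filter_insert]
    split_ifs <;> simp_all
  have hsgen (x y : Fin (N + 1)) (hxy : (x : ℕ) + 1 = y) : sgen (N + 1) (x + 1) = swap x y := by
    have := y.2
    rw [sgen, dif_pos (by omega)]
    congr 1
    ext; simp; omega
  have hsurj (M : ℕ) : ∀ j ≤ f M, ∃ i ≤ M, f i = j := by
    induction M with
    | zero =>
      intro j hj
      exact ⟨0, le_rfl, by simp [hf] at hj ⊢; omega⟩
    | succ M ih =>
      intro j hj
      by_cases h : j ≤ f M
      · obtain ⟨i, hi, h⟩ := ih j h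
        exact ⟨i, by omega, h⟩
      · refine ⟨M + 1, le_rfl, ?_⟩
        have := hsucc M
        split_ifs at this <;> omega
  have hcard : ((range N).filter fun j => sgen (N + 1) (j + 1) ∈ K).card = K.card := by
    refine card_bij (fun j _ => sgen (N + 1) (j + 1)) ?_ ?_ ?_
    · intro j hj
      exact (mem_filter.1 hj).2
    · intro i hi j hj h
      have hi := mem_range.1 (mem_filter.1 hi).1
      have hj := mem_range.1 (mem_filter.1 hj).1
      have := swap_adjacent_inj (x := (⟨i, by omega⟩ : Fin (N + 1))) (y := ⟨i + 1, by omega⟩)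
        (x' := ⟨j, by omega⟩) (y' := ⟨j + 1, by omega⟩) rfl rfl
        (by rw [← hsgen _ _ rfl, ← hsgen _ _ rfl]; exact h)
      simpa using this.1
    · intro g hg
      obtain ⟨x, y, hxy, rfl⟩ := mem_Simples.1 (hK hg)
      have := y.2
      exact ⟨x, by simp [hsgen x y hxy, hg]; omega, hsgen x y hxy⟩
  refine ⟨f N + 1, ?_, fun x => ⟨f x, Nat.lt_succ_of_le (hmono (by omega))⟩, ?_, ?_, ?_⟩
  · have h := card_filter_add_card_filter_not (s := range N)
      (fun j => sgen (N + 1) (j + 1) ∈ K)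
    simp only [card_range] at h
    simp only [hf]
    omega
  · exact fun x y h => Fin.mk_le_mk.2 (hmono (Fin.le_def.1 h))
  · intro j
    obtain ⟨i, hi, h⟩ := hsurj N j (by omega)
    exact ⟨⟨i, by omega⟩, by ext; exact h⟩
  · intro x y hxy
    have := hsucc x
    rw [hsgen x y hxy, hxy] at this
    constructor <;> intro h <;> simp only [h, if_true, if_false] at this <;> simp [this]

lemma eq_of_eq_of_adjacent {α β : Type*} [PartialOrder α] {f : Fin n → α} {g : Fin n → β}
    (hf : Monotone f) (h : ∀ x y : Fin n, (x : ℕ) + 1 = y → f x = f y → g x = g y)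
    {x y : Fin n} (hxy : f x = f y) : g x = g y := by
  have key (x : Fin n) (k : ℕ) : ∀ y : Fin n, (y : ℕ) = x + k → f x = f y → g x = g y := by
    induction k with
    | zero =>
      intro y hy _
      rw [show x = y from Fin.ext hy.symm]
    | succ k ih =>
      intro y hy hxy
      have hz : (x : ℕ) + k < n := by have := y.2; omega
      have h1 : f x ≤ f ⟨x + k, hz⟩ := hf (Fin.le_def.2 (by simp))
      have h2 : f ⟨x + k, hz⟩ ≤ f y := hf (Fin.le_def.2 (by simp; omega))
      have h3 : f x = f ⟨x + k, hz⟩ := le_antisymm h1 (hxy ▸ h2)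
      exact (ih _ rfl h3).trans (h _ _ (by simp; omega) (h3.symm.trans hxy))
  rcases le_total x y with h' | h'
  · exact key x (y - x) y (by omega) hxy
  · exact (key y (x - y) x (by omega) hxy.symm).symm

/-- Weakly increasing maps with a given set of level positions are counted by a binomial
coefficient. -/
lemma card_monotone_level (hn : 0 < n) {K : Finset (Perm (Fin n))} (hK : K ⊆ Simples n) (s : ℕ) :
    (univ.filter fun b : Fin n → Fin s => Monotone b ∧
      ∀ x y : Fin n, (x : ℕ) + 1 = y → (b x = b y ↔ swap x y ∈ K)).card
      = s.choose (n - K.card) := by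
  obtain ⟨m, hm, β, hβ, hsurj, hadj⟩ := exists_blockMap hn hK
  have hβK (x y : Fin n) (hxy : (x : ℕ) + 1 = y) : β x = β y ↔ swap x y ∈ K := by
    refine ⟨fun h => ?_, (hadj x y hxy).1⟩
    by_contra hs
    have := (hadj x y hxy).2 hs
    rw [h] at this
    omega
  rw [show n - K.card = m by omega]
  trans (powersetCard m (univ : Finset (Fin s))).card
  · symm
    refine card_bij (fun T hT => T.orderEmbOfFin (mem_powersetCard.1 hT).2 ∘ β) ?_ ?_ ?_
    · intro T hT
      simp only [mem_filter, mem_univ, true_and]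
      refine ⟨(OrderEmbedding.monotone _).comp hβ, fun x y hxy => ?_⟩
      rw [← hβK x y hxy]
      simp
    · intro T hT T' hT' h
      have := congrArg Set.range h
      rw [hsurj.range_comp, hsurj.range_comp, range_orderEmbOfFin, range_orderEmbOfFin] at this
      exact_mod_cast this
    · intro b hb
      simp only [mem_filter, mem_univ, true_and] at hb
      obtain ⟨hb, hbK⟩ := hb
      have h1 {x y : Fin n} (h : b x = b y) : β x = β y :=
        eq_of_eq_of_adjacent hb (fun x y hxy h => (hβK x y hxy).2 ((hbK x y hxy).1 h)) h
      have h2 {x y : Fin n} (h : β x = β y) : b x = b y :=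
        eq_of_eq_of_adjacent hβ (fun x y hxy h => (hbK x y hxy).2 ((hβK x y hxy).1 h)) h
      choose ι hι using hsurj
      have hmono : StrictMono (b ∘ ι) := by
        intro p q hpq
        have h3 : ι p < ι q := by
          by_contra h
          have := hβ (not_lt.1 h)
          rw [hι, hι] at this
          exact absurd hpq (not_lt.2 this)
        refine lt_of_le_of_ne (hb h3.le) fun h => ?_
        have := h1 h
        rw [hι, hι] at this
        exact hpq.ne this
      have hc : (univ.image (b ∘ ι)).card = m := by
        rw [card_image_of_injective _ hmono.injective, card_fin]
      refine ⟨univ.image (b ∘ ι), mem_powersetCard.2 ⟨subset_univ _, hc⟩, ?_⟩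
      rw [← orderEmbOfFin_unique hc (f := b ∘ ι) (by simp) hmono]
      funext x
      exact h2 (hι (β x))
  · simp

lemma sort_inv_lt {α : Type*} [LinearOrder α] (a : Fin n → α) (x y : Fin n) :
    (Tuple.sort a)⁻¹ x < (Tuple.sort a)⁻¹ y ↔ a x < a y ∨ (a x = a y ∧ x < y) := by
  have h (x : Fin n) : (Tuple.sort a) ((Tuple.sort a)⁻¹ x) = x := (Tuple.sort a).apply_symm_apply x
  rw [← (Tuple.graphEquiv₂ a).lt_iff_lt, Tuple.graphEquiv₂_apply, Tuple.graphEquiv₂_apply, h, h]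
  exact Prod.Lex.lt_iff

/-- The level positions of a map, as a set of simple reflections. -/
def levels {α : Type*} (b : Fin n → α) : Finset (Perm (Fin n)) :=
  (Simples n).filter fun g => ∃ x y : Fin n, (x : ℕ) + 1 = y ∧ g = swap x y ∧ b x = b y

lemma levels_subset {α : Type*} (b : Fin n → α) : levels b ⊆ Simples n :=
  filter_subset _ _

lemma swap_mem_levels {α : Type*} {b : Fin n → α} {x y : Fin n} (hxy : (x : ℕ) + 1 = y) :
    swap x y ∈ levels b ↔ b x = b y := by
  simp only [levels, mem_filter]
  constructor
  · rintro ⟨-, x', y', h, he, hb⟩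
    obtain ⟨rfl, rfl⟩ := swap_adjacent_inj hxy h he
    exact hb
  · exact fun h => ⟨mem_Simples.2 ⟨x, y, hxy, rfl⟩, x, y, hxy, rfl, h⟩

lemma eq_levels_iff {α : Type*} {b : Fin n → α} {K : Finset (Perm (Fin n))} (hK : K ⊆ Simples n) :
    levels b = K ↔ ∀ x y : Fin n, (x : ℕ) + 1 = y → (b x = b y ↔ swap x y ∈ K) := by
  constructor
  · rintro rfl x y hxy
    exact (swap_mem_levels hxy).symm
  · intro h
    ext g
    by_cases hg : g ∈ Simples n
    · obtain ⟨x, y, hxy, rfl⟩ := mem_Simples.1 hg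
      rw [swap_mem_levels hxy, h x y hxy]
    · exact ⟨fun h' => absurd (levels_subset b h') hg, fun h' => absurd (hK h') hg⟩

lemma eq_sort_iff_levels {α : Type*} [LinearOrder α] {a : Fin n → α} {w : Perm (Fin n)} :
    Tuple.sort a = w ↔ Monotone (a ∘ w) ∧ w ∈ minCoset n Set.univ (levels (a ∘ w)) := by
  rw [mem_minCoset (levels_subset _)]
  constructor
  · rintro rfl
    refine ⟨Tuple.monotone_sort a, fun x y hxy h => ?_⟩
    rw [swap_mem_levels hxy] at h
    have h' (x : Fin n) : (Tuple.sort a)⁻¹ (Tuple.sort a x) = x := (Tuple.sort a).symm_apply_apply x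
    have := (sort_inv_lt a (Tuple.sort a x) (Tuple.sort a y)).1
      (by rw [h', h', Fin.lt_def]; omega)
    rcases this with h' | h'
    · exact absurd h h'.ne
    · exact h'.2
  · rintro ⟨h1, h2⟩
    have key : (Tuple.sort a)⁻¹ * w = 1 := by
      refine perm_eq_one_of_adjacent fun x y hxy => ?_
      rw [Perm.mul_apply, Perm.mul_apply, sort_inv_lt]
      have h3 : a (w x) ≤ a (w y) := h1 (Fin.le_def.2 (by omega))
      rcases h3.lt_or_eq with h | h
      · exact Or.inl h
      · exact Or.inr ⟨h, h2 x y hxy ((swap_mem_levels hxy).2 h)⟩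
    rwa [inv_mul_eq_one] at key

/-- The number of maps with a given stable sorting permutation. -/
lemma card_sort_eq (hn : 0 < n) (s : ℕ) (w : Perm (Fin n)) :
    (univ.filter fun a : Fin n → Fin s => Tuple.sort a = w).card =
      ∑ K ∈ (Simples n).powerset,
        if w ∈ minCoset n Set.univ K then s.choose (n - K.card) else 0 := by
  have h1 : (univ.filter fun a : Fin n → Fin s => Tuple.sort a = w).card =
      (univ.filter fun b : Fin n → Fin s =>
        Monotone b ∧ w ∈ minCoset n Set.univ (levels b)).card := by
    refine card_bij (fun a _ => a ∘ w) ?_ ?_ ?_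
    · intro a ha
      simpa using eq_sort_iff_levels.1 (mem_filter.1 ha).2
    · intro a _ b _ h
      exact w.surjective.injective_comp_right h
    · intro b hb
      refine ⟨b ∘ w.symm, ?_, by simp [Function.comp_assoc]⟩
      simpa [eq_sort_iff_levels, Function.comp_assoc] using hb
  rw [h1, card_eq_sum_card_fiberwise (f := levels) (t := (Simples n).powerset)
    (fun b _ => mem_coe.2 (mem_powerset.2 (levels_subset b)))]
  refine sum_congr rfl fun K hK => ?_
  rw [mem_powerset] at hK
  split_ifs with hw
  · rw [← card_monotone_level hn hK, filter_filter]
    congr 1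
    ext b
    simp only [mem_filter, mem_univ, true_and, ← eq_levels_iff hK]
    constructor
    · rintro ⟨⟨h, -⟩, h'⟩
      exact ⟨h, h'⟩
    · rintro ⟨h, rfl⟩
      exact ⟨⟨h, hw⟩, rfl⟩
  · rw [filter_filter, card_eq_zero, filter_eq_empty_iff]
    rintro b - ⟨⟨-, h⟩, rfl⟩
    exact hw h

/-- Compatibility of a map on a set of points with `K` and a tie-breaking permutation `u`. -/
def IsCompatible (K : Finset (Perm (Fin n))) (u : Perm (Fin n)) (A : Fin n → Prop)
    (a : {x // A x} → ℕ) : Prop :=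
  ∀ x y : {x // A x}, (x : ℕ) + 1 = y → swap (x : Fin n) y ∈ K →
    a x < a y ∨ (a x = a y ∧ u x < u y)

lemma exists_polynomial_compatible (K : Finset (Perm (Fin n))) (u : Perm (Fin n))
    (A : Fin n → Prop) [DecidablePred A] (hA : ∃ x, A x) :
    ∃ p : Polynomial ℂ, p.eval 0 = 0 ∧ ∀ s : ℕ, p.eval (s : ℂ) =
      (univ.filter fun a : {x // A x} → Fin s => IsCompatible K u A fun i => a i).card := by
  have : Nonempty {x // A x} := ⟨⟨_, hA.choose_spec⟩⟩
  refine exists_polynomial_card (IsCompatible K u A) fun a b hab h x y hxy hK => ?_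
  have h1 := hab x y
  have h2 := hab y x
  have h3 := h x y hxy hK
  omega

lemma exists_polynomial_sort_inv_mul_mem {K : Finset (Perm (Fin n))} (hK : K ⊂ Simples n)
    (u : Perm (Fin n)) :
    ∃ p q : Polynomial ℂ, p.eval 0 = 0 ∧ q.eval 0 = 0 ∧ ∀ s : ℕ, (p * q).eval (s : ℂ) =
      (univ.filter fun a : Fin n → Fin s =>
        (Tuple.sort a)⁻¹ * u ∈ minCoset n Set.univ K).card := by
  obtain ⟨g, hg, hgK⟩ := exists_of_ssubset hK
  obtain ⟨x₀, y₀, hxy₀, rfl⟩ := mem_Simples.1 hg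
  obtain ⟨A, hA⟩ : ∃ A : Fin n → Prop, ∀ x, A x ↔ x ≤ x₀ := ⟨_, fun _ => Iff.rfl⟩
  obtain ⟨p, hp0, hp⟩ := exists_polynomial_compatible K u A ⟨x₀, (hA _).2 le_rfl⟩
  obtain ⟨q, hq0, hq⟩ := exists_polynomial_compatible K u (fun x => ¬ A x)
    ⟨y₀, by rw [hA, Fin.le_def]; omega⟩
  refine ⟨p, q, hp0, hq0, fun s => ?_⟩
  rw [Polynomial.eval_mul, hp, hq, ← Nat.cast_mul, ← card_product, Nat.cast_inj]
  symm
  refine card_equiv ((u.arrowCongr (Equiv.refl (Fin s))).symm.trans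
    (Equiv.piEquivPiSubtypeProd A fun _ => Fin s)) fun a => ?_
  have h0 : a ∈ univ.filter (fun a : Fin n → Fin s =>
      (Tuple.sort a)⁻¹ * u ∈ minCoset n Set.univ K) ↔ ∀ x y : Fin n, (x : ℕ) + 1 = y →
        swap x y ∈ K → (a (u x) : ℕ) < a (u y) ∨ ((a (u x) : ℕ) = a (u y) ∧ u x < u y) := by
    simp only [mem_filter, mem_univ, true_and, mem_minCoset hK.subset, Perm.mul_apply,
      sort_inv_lt, Fin.val_inj, Fin.val_fin_lt]
  rw [h0, mem_product, mem_filter, mem_filter]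
  constructor
  · exact fun h => ⟨⟨mem_univ _, fun x y => h x y⟩, ⟨mem_univ _, fun x y => h x y⟩⟩
  · rintro ⟨⟨-, h1⟩, -, h2⟩ x y hxy hs
    by_cases hx : A x
    · have hy : A y := by
        by_contra hy
        rw [hA] at hx hy
        obtain rfl : x = x₀ := by ext; simp only [Fin.le_def] at *; omega
        obtain rfl : y = y₀ := by ext; omega
        exact hgK hs
      exact h1 ⟨x, hx⟩ ⟨y, hy⟩ hxy hs
    · have hy : ¬ A y := by simp only [hA, Fin.le_def] at *; omega
      exact h2 ⟨x, hx⟩ ⟨y, hy⟩ hxy hs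

/-- The first Eulerian idempotent, as a combination of the `x_K`. -/
def eulerian (n : ℕ) : MonoidAlgebra ℂ (Perm (Fin n)) :=
  ∑ K ∈ (Simples n).powerset, linCoeff (n - K.card) • xRel n Set.univ K

lemma coeff_xRel (K : Finset (Perm (Fin n))) (u : Perm (Fin n)) :
    (xRel n Set.univ K).coeff u = if u ∈ minCoset n Set.univ K then 1 else 0 := by
  simp [xRel, coeff_sum, Finsupp.single_apply]

lemma coeff_mul_apply (x y : MonoidAlgebra ℂ (Perm (Fin n))) (u : Perm (Fin n)) :
    (x * y).coeff u = ∑ v, x.coeff v * y.coeff (v⁻¹ * u) := by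
  rw [MonoidAlgebra.coeff_mul_apply_left, Finsupp.sum_fintype _ _ (by simp)]

lemma eulerian_mul_xRel (hn : 0 < n) {K : Finset (Perm (Fin n))} (hK : K ⊂ Simples n) :
    eulerian n * xRel n Set.univ K = 0 := by
  ext u
  obtain ⟨p, q, hp, hq, h⟩ := exists_polynomial_sort_inv_mul_mem hK u
  set y : Perm (Fin n) → ℂ := fun v => (xRel n Set.univ K).coeff (v⁻¹ * u) with hy
  have key : p * q = ∑ v, ∑ L ∈ (Simples n).powerset,
      Polynomial.C ((xRel n Set.univ L).coeff v * y v) * choosePoly (n - L.card) := by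
    refine eq_of_eval_natCast_eq fun s => ?_
    rw [h, card_eq_sum_card_fiberwise (f := Tuple.sort) (t := univ) (by simp),
      Polynomial.eval_finsetSum, Nat.cast_sum]
    refine sum_congr rfl fun v _ => ?_
    rw [Polynomial.eval_finsetSum, filter_filter]
    simp only [Polynomial.eval_mul, Polynomial.eval_C, eval_choosePoly]
    by_cases hv : v⁻¹ * u ∈ minCoset n Set.univ K
    · have : (univ.filter fun a : Fin n → Fin s =>
          (Tuple.sort a)⁻¹ * u ∈ minCoset n Set.univ K ∧ Tuple.sort a = v) =
          univ.filter fun a : Fin n → Fin s => Tuple.sort a = v :=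
        filter_congr fun a _ => ⟨And.right, fun h => ⟨h ▸ hv, h⟩⟩
      rw [this, card_sort_eq hn, Nat.cast_sum]
      refine sum_congr rfl fun L _ => ?_
      rw [hy]
      simp only [coeff_xRel, hv]
      split_ifs <;> simp
    · rw [filter_eq_empty_iff.2 (by rintro a - ⟨h, rfl⟩; exact hv h)]
      simp [hy, coeff_xRel, hv]
  have hD := congrArg (fun r => r.derivative.eval 0) key
  simp only [Polynomial.derivative_mul, Polynomial.eval_add, Polynomial.eval_mul, hp, hq, mul_zero,
    zero_mul, add_zero, Polynomial.derivative_sum, Polynomial.eval_finsetSum,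
    Polynomial.derivative_C, Polynomial.eval_C, zero_add] at hD
  rw [coeff_mul_apply, coeff_zero, Finsupp.zero_apply, hD]
  refine sum_congr rfl fun v _ => ?_
  simp only [eulerian, coeff_sum, Finsupp.finsetSum_apply, coeff_smul, Finsupp.smul_apply,
    smul_eq_mul, sum_mul]
  refine sum_congr rfl fun L _ => ?_
  rw [hy, linCoeff]
  ring

lemma perm_eq_of_lt_iff {v w : Perm (Fin n)} (h : ∀ x y, v x < v y ↔ w x < w y) : v = w := by
  have : w * v⁻¹ = 1 := by
    refine perm_eq_one_of_adjacent fun x y hxy => ?_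
    rw [Perm.mul_apply, Perm.mul_apply, ← h]
    change v (v.symm x) < v (v.symm y)
    rw [apply_symm_apply, apply_symm_apply, Fin.lt_def]
    omega
  rw [mul_inv_eq_one] at this
  exact this.symm

lemma val_add_one_eq_of_forall {w : Perm (Fin n)} {x y : Fin n} (h : w x < w y)
    (h' : ∀ z, w x < w z → ¬ w z < w y) : (w x : ℕ) + 1 = w y := by
  by_contra hne
  have h1 : (w x : ℕ) + 1 < w y := by rw [Fin.lt_def] at h; omega
  have := (w y).2
  refine h' (w.symm ⟨w x + 1, by omega⟩) ?_ ?_ <;>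
    rw [apply_symm_apply, Fin.lt_def] <;> simp only <;> omega

/-- Pairs of a permutation carrying `J` into the simple reflections and a weakly increasing map
constant along `J`, such that the permutation is increasing along the levels of the map. -/
def takesPairs (J : Finset (Perm (Fin n))) (s : ℕ) : Finset (Perm (Fin n) × (Fin n → Fin s)) :=
  univ.filter fun P => Takes n (Simples n) P.1 J ∧ J ⊆ levels P.2 ∧ Monotone P.2 ∧
    P.1 ∈ minCoset n Set.univ (levels P.2)

lemma card_takesPairs_eq_sum (hn : 0 < n) (J : Finset (Perm (Fin n))) (s : ℕ) :
    (takesPairs J s).card =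
      ∑ K ∈ (Simples n).powerset, s.choose (n - K.card) * mC n Set.univ (Simples n) J K := by
  rw [card_eq_sum_card_fiberwise (f := fun P => levels P.2) (t := (Simples n).powerset)
    (fun P _ => mem_coe.2 (mem_powerset.2 (levels_subset P.2)))]
  refine sum_congr rfl fun K hK => ?_
  rw [mem_powerset] at hK
  rw [mC]
  split_ifs with hJ
  · rw [← card_monotone_level hn hK, mul_comm, ← card_product, takesPairs, filter_filter]
    congr 1
    ext ⟨w, b⟩
    simp only [mem_filter, mem_univ, true_and, ← eq_levels_iff hK, mem_product]
    constructor
    · rintro ⟨⟨h1, h2, h3, h4⟩, rfl⟩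
      exact ⟨⟨h4, h1⟩, h3, rfl⟩
    · rintro ⟨⟨h1, h2⟩, h3, rfl⟩
      exact ⟨⟨h2, hJ, h3, h1⟩, rfl⟩
  · rw [mul_zero, takesPairs, filter_filter, card_eq_zero, filter_eq_empty_iff]
    rintro ⟨w, b⟩ - ⟨⟨-, h, -⟩, rfl⟩
    exact hJ h

lemma lt_iff_sort {α : Type*} [LinearOrder α] (a : Fin n → α) (x y : Fin n) :
    x < y ↔ a (Tuple.sort a x) < a (Tuple.sort a y) ∨
      (a (Tuple.sort a x) = a (Tuple.sort a y) ∧ Tuple.sort a x < Tuple.sort a y) := by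
  have h (x : Fin n) : (Tuple.sort a)⁻¹ (Tuple.sort a x) = x := (Tuple.sort a).symm_apply_apply x
  rw [← sort_inv_lt, h, h]

lemma card_takesPairs (hn : 0 < n) {J : Finset (Perm (Fin n))} (hJ : J ⊆ Simples n) (s : ℕ) :
    (takesPairs J s).card = s ^ (n - J.card) := by
  obtain ⟨m, hm, β, hβ, hsurj, hadj⟩ := exists_blockMap hn hJ
  have hβJ {x y : Fin n} (hxy : (x : ℕ) + 1 = y) : β x = β y ↔ swap x y ∈ J := by
    refine ⟨fun h => ?_, (hadj x y hxy).1⟩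
    by_contra hs
    have := (hadj x y hxy).2 hs
    rw [h] at this
    omega
  rw [show n - J.card = m by omega]
  trans (univ : Finset (Fin m → Fin s)).card
  swap
  · simp
  symm
  have hlt (π : Perm (Fin m)) (x y : Fin n) :
      (Tuple.sort (π ∘ β))⁻¹ x < (Tuple.sort (π ∘ β))⁻¹ y ↔
        π (β x) < π (β y) ∨ (β x = β y ∧ x < y) := by
    rw [sort_inv_lt]
    simp
  refine card_bij (fun a _ => ((Tuple.sort (Tuple.sort a ∘ β))⁻¹, a ∘ Tuple.sort a ∘ β)) ?_ ?_ ?_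
  · intro a _
    have hlev : J ⊆ levels (a ∘ Tuple.sort a ∘ β) := by
      intro g hg
      obtain ⟨x, y, hxy, rfl⟩ := mem_Simples.1 (hJ hg)
      rw [swap_mem_levels hxy]
      simp [(hβJ hxy).2 hg]
    simp only [takesPairs, mem_filter, mem_univ, true_and]
    refine ⟨(takes_iff hJ).2 fun x y hxy hs => ?_, hlev,
      (Tuple.monotone_sort a).comp hβ, (mem_minCoset (levels_subset _)).2 fun x y hxy hs => ?_⟩
    · have hb := (hβJ hxy).2 hs
      refine val_add_one_eq_of_forall ?_ fun z => ?_
      · rw [hlt]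
        exact Or.inr ⟨hb, by rw [Fin.lt_def]; omega⟩
      · rw [hlt, hlt, hb]
        rintro (h | h) (h' | h')
        · exact absurd h h'.not_gt
        · exact absurd h (by simp [h'.1])
        · exact absurd h' (by simp [h.1])
        · have h1 := h.2
          have h2 := h'.2
          rw [Fin.lt_def] at h1 h2
          omega
    · rw [hlt]
      rw [swap_mem_levels hxy] at hs
      by_cases hb : swap x y ∈ J
      · exact Or.inr ⟨(hβJ hxy).2 hb, by rw [Fin.lt_def]; omega⟩
      · have h1 := (hadj x y hxy).2 hb
        have h2 : β x < β y := by rw [Fin.lt_def]; omega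
        rcases (lt_iff_sort a (β x) (β y)).1 h2 with h | h
        · exact absurd hs h.ne
        · exact Or.inl h.2
  · intro a _ a' _ h
    obtain ⟨h1, h2⟩ := Prod.mk.inj h
    have hs : Tuple.sort a = Tuple.sort a' := by
      refine perm_eq_of_lt_iff fun p q => ?_
      obtain ⟨x, rfl⟩ := hsurj p
      obtain ⟨y, rfl⟩ := hsurj q
      by_cases hb : β x = β y
      · simp [hb]
      · have h3 := hlt (Tuple.sort a) x y
        rw [h1, hlt (Tuple.sort a') x y] at h3
        simpa [hb] using h3.symm
    rw [hs] at h2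
    funext p
    obtain ⟨x, hx⟩ := hsurj ((Tuple.sort a').symm p)
    simpa [hx] using congrFun h2 x
  · rintro ⟨w, b⟩ hP
    simp only [takesPairs, mem_filter, mem_univ, true_and] at hP
    obtain ⟨htak, hlev, hb, hw⟩ := hP
    rw [takes_iff hJ] at htak
    have hbβ {x y : Fin n} (h : β x = β y) : b x = b y :=
      eq_of_eq_of_adjacent hβ
        (fun x y hxy h => (swap_mem_levels hxy).1 (hlev ((hβJ hxy).1 h))) h
    have hsort : Tuple.sort (b ∘ w.symm) = w := by
      rw [eq_sort_iff_levels]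
      simpa [Function.comp_assoc] using ⟨hb, hw⟩
    have hlw (x y : Fin n) : x < y ↔ b x < b y ∨ (b x = b y ∧ w x < w y) := by
      simpa [hsort] using lt_iff_sort (b ∘ w.symm) x y
    choose ι hι using hsurj
    have hιlt {p q : Fin m} (h : p < q) : ι p < ι q := by
      by_contra h'
      have := hβ (not_lt.1 h')
      rw [hι, hι] at this
      exact absurd h (not_lt.2 this)
    have hιinj : Function.Injective ι := fun p q h => by rw [← hι p, h, hι]
    have hblock {x x' z : Fin n} (h : β x = β x') (hz : β x ≠ β z) : w x < w z ↔ w x' < w z := by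
      have := eq_of_eq_of_adjacent (g := fun x => β x ≠ β z ∧ w x < w z) hβ
        (fun x y hxy h => propext ?_) h
      · simpa [hz, ← h] using this
      · simp only [h]
        refine and_congr_right fun hz => ?_
        have h1 := htak x y hxy ((hβJ hxy).1 h)
        have h2 : w x ≠ w z := fun h' => hz (by rw [← h, w.injective h'])
        have h3 : w y ≠ w z := fun h' => hz (by rw [w.injective h'])
        simp only [Fin.lt_def, ne_eq, Fin.ext_iff] at *
        omega
    have hblock' {x y : Fin n} (h : β x ≠ β y) : w (ι (β x)) < w (ι (β y)) ↔ w x < w y := by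
      rw [hblock (x' := x) (by rw [hι]) (by rwa [hι, hι])]
      have h1 : w (ι (β y)) < w x ↔ w y < w x := hblock (hι _) (by rw [hι]; exact h.symm)
      have h2 : w x ≠ w (ι (β y)) := fun h' => h (by
        have := congrArg β (w.injective h')
        rwa [hι] at this)
      have h3 : w x ≠ w y := fun h' => h (by rw [w.injective h'])
      simp only [Fin.lt_def, ne_eq, Fin.ext_iff] at *
      omega
    set π : Perm (Fin m) := (Tuple.sort (w ∘ ι))⁻¹ with hπ
    have hπlt (p q : Fin m) : π p < π q ↔ w (ι p) < w (ι q) := by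
      rw [hπ, sort_inv_lt]
      refine or_iff_left ?_
      rintro ⟨h, h'⟩
      exact h'.ne (hιinj (w.injective h))
    have hsortπ : Tuple.sort (b ∘ ι ∘ π.symm) = π := by
      rw [eq_sort_iff_levels, mem_minCoset (levels_subset _)]
      have hc : (b ∘ ι ∘ π.symm) ∘ π = b ∘ ι := by simp [Function.comp_assoc]
      rw [hc]
      refine ⟨hb.comp (monotone_of_adjacent fun p q hpq =>
        (hιlt (by rw [Fin.lt_def]; omega)).le), fun p q hpq hs => ?_⟩
      rw [swap_mem_levels hpq] at hs
      rw [hπlt]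
      rcases (hlw (ι p) (ι q)).1 (hιlt (by rw [Fin.lt_def]; omega)) with h | h
      · exact absurd hs h.ne
      · exact h.2
    refine ⟨b ∘ ι ∘ π.symm, mem_univ _, ?_⟩
    rw [hsortπ]
    refine Prod.ext (perm_eq_of_lt_iff fun x y => ?_) (funext fun x => ?_)
    · dsimp only
      rw [hlt, hπlt]
      by_cases h : β x = β y
      · have := hlw x y
        rw [hbβ h] at this
        simpa [h] using this
      · simpa [h] using hblock' h
    · have : b (ι (β x)) = b x := hbβ (hι _)
      simpa using this

lemma card_Simples (hn : 0 < n) : (Simples n).card = n - 1 := by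
  obtain ⟨m, hm, β, -, hsurj, hadj⟩ := exists_blockMap hn (Subset.refl (Simples n))
  have h (x y : Fin n) : β x = β y :=
    eq_of_eq_of_adjacent (f := fun _ => ()) monotone_const
      (fun x y hxy _ => (hadj x y hxy).1 (mem_Simples.2 ⟨x, y, hxy, rfl⟩)) rfl
  have h1 : Subsingleton (Fin m) := ⟨fun p q => by
    obtain ⟨x, rfl⟩ := hsurj p
    obtain ⟨y, rfl⟩ := hsurj q
    exact h x y⟩
  have h2 := (β ⟨0, hn⟩).2
  have h3 := Fin.subsingleton_iff_le_one.1 h1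
  omega

lemma sum_linCoeff_mul_mC (hn : 0 < n) {J : Finset (Perm (Fin n))} (hJ : J ⊆ Simples n) :
    ∑ K ∈ (Simples n).powerset, linCoeff (n - K.card) * mC n Set.univ (Simples n) J K =
      if J = Simples n then 1 else 0 := by
  have key : ∑ K ∈ (Simples n).powerset,
      choosePoly (n - K.card) * Polynomial.C (mC n Set.univ (Simples n) J K : ℂ) =
        Polynomial.X ^ (n - J.card) := by
    refine eq_of_eval_natCast_eq fun s => ?_
    have h := card_takesPairs_eq_sum hn J s
    rw [card_takesPairs hn hJ] at h
    have h' := congrArg (Nat.cast (R := ℂ)) h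
    push_cast at h'
    simp [Polynomial.eval_finsetSum, eval_choosePoly, h']
  have hD := congrArg (fun r => r.derivative.eval 0) key
  simp only [Polynomial.derivative_sum, Polynomial.eval_finsetSum, Polynomial.derivative_mul,
    Polynomial.derivative_C, mul_zero, add_zero, Polynomial.eval_mul, Polynomial.eval_C] at hD
  simp only [linCoeff]
  rw [hD]
  have h1 := card_Simples hn
  split_ifs with h
  · rw [h, h1, show n - (n - 1) = 1 by omega]
    simp
  · have h2 := card_lt_card (lt_of_le_of_ne hJ h)
    obtain ⟨r, hr⟩ : ∃ r, n - J.card = r + 2 := ⟨n - J.card - 2, by omega⟩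
    rw [hr]
    simp

lemma eq_eulerian (hn : 0 < n) {e : Finset (Perm (Fin n)) → MonoidAlgebra ℂ (Perm (Fin n))}
    (he : IsBBHT n Set.univ (Simples n) e) : e (Simples n) = eulerian n := by
  have h1 : eulerian n = ∑ K ∈ (Simples n).powerset, ∑ J ∈ (Simples n).powerset,
      (linCoeff (n - K.card) * mC n Set.univ (Simples n) J K) • e J := by
    refine sum_congr rfl fun K hK => ?_
    rw [he K hK, smul_sum]
    simp only [smul_smul]
    refine sum_subset (powerset_mono.2 (mem_powerset.1 hK)) fun J _ hJ => ?_
    rw [mem_powerset] at hJ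
    simp [mC, hJ]
  rw [h1, sum_comm]
  simp only [← sum_smul]
  rw [sum_congr rfl fun J hJ => by rw [sum_linCoeff_mul_mC hn (mem_powerset.1 hJ)]]
  simp

lemma xRel_Simples : xRel n Set.univ (Simples n) = 1 := by
  have : minCoset n Set.univ (Simples n) = {1} := by
    ext w
    rw [mem_minCoset (Subset.refl _), mem_singleton]
    constructor
    · exact fun h => perm_eq_one_of_adjacent fun x y hxy =>
        h x y hxy (mem_Simples.2 ⟨x, y, hxy, rfl⟩)
    · rintro rfl x y hxy -
      rw [Perm.one_apply, Perm.one_apply, Fin.lt_def]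
      omega
  rw [xRel, this, sum_singleton, map_one]

lemma eulerian_mul_self (hn : 0 < n) : eulerian n * eulerian n = eulerian n := by
  conv_lhs => rw [eulerian.eq_1 n, mul_sum]
  rw [← eulerian, sum_eq_single (Simples n)]
  · rw [xRel_Simples, card_Simples hn, show n - (n - 1) = 0 + 1 by omega, linCoeff_succ]
    simp
  · intro K hK hne
    rw [mul_smul_comm, eulerian_mul_xRel hn ((mem_powerset.1 hK).ssubset_of_ne hne), smul_zero]
  · simp

lemma coeff_eulerian_one (hn : 0 < n) : (eulerian n).coeff 1 = (n : ℂ)⁻¹ := by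
  have h1 (K : Finset (Perm (Fin n))) (hK : K ∈ (Simples n).powerset) :
      (linCoeff (n - K.card) • xRel n Set.univ K).coeff 1 = linCoeff (n - K.card) := by
    have : (1 : Perm (Fin n)) ∈ minCoset n Set.univ K := by
      rw [mem_minCoset (mem_powerset.1 hK)]
      intro x y hxy _
      rw [Perm.one_apply, Perm.one_apply, Fin.lt_def]
      omega
    simp [coeff_xRel, this]
  rw [eulerian, coeff_sum, Finsupp.finsetSum_apply, sum_congr rfl h1,
    sum_powerset_apply_card (fun j => linCoeff (n - j)), card_Simples hn]
  obtain ⟨N, rfl⟩ : ∃ N, n = N + 1 := ⟨n - 1, by omega⟩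
  rw [Nat.add_sub_cancel, ← sum_range_reflect]
  have h2 := Int.alternating_sum_range_choose (n := N + 1)
  rw [sum_range_succ', if_neg (by omega)] at h2
  have h3 : ∑ j ∈ range (N + 1), (-1 : ℂ) ^ j * (N + 1).choose (j + 1) = 1 := by
    have := congrArg (Int.cast (R := ℂ)) h2
    push_cast at this
    simp only [pow_succ, mul_neg, mul_one, neg_mul, sum_neg_distrib,
      Nat.choose_zero_right, Nat.cast_one] at this
    linear_combination -this
  have h4 : (N : ℂ) + 1 ≠ 0 := by exact_mod_cast N.succ_ne_zero
  push_cast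
  rw [← one_div, eq_div_iff h4, sum_mul]
  refine Eq.trans ?_ h3
  refine sum_congr rfl fun j hj => ?_
  rw [mem_range] at hj
  have h5 : (j : ℂ) + 1 ≠ 0 := by exact_mod_cast j.succ_ne_zero
  have h6 : ((N : ℂ) + 1) * N.choose j = (N + 1).choose (j + 1) * (j + 1) := by
    exact_mod_cast Nat.add_one_mul_choose_eq N j
  rw [Nat.choose_symm (by omega),
    show N + 1 - (N - j) = j + 1 by omega, linCoeff_succ, nsmul_eq_mul]
  field_simp
  linear_combination h6

section Trace

variable {G : Type*} [Group G] [Fintype G]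

lemma trace_mulLeft_comp_mulRight (a : MonoidAlgebra ℂ G) (w : G) :
    LinearMap.trace ℂ _ (LinearMap.mulLeft ℂ a ∘ₗ LinearMap.mulRight ℂ (of ℂ G w)) =
      ∑ x, a.coeff (x * w⁻¹ * x⁻¹) := by
  rw [LinearMap.trace_eq_matrix_trace ℂ (MonoidAlgebra.basis G ℂ), Matrix.trace]
  refine sum_congr rfl fun x _ => ?_
  rw [Matrix.diag_apply, LinearMap.toMatrix_apply, basis_apply]
  change (a * (single x 1 * of ℂ G w)).coeff x = _
  rw [of_apply, single_mul_single, coeff_mul_single_apply]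
  simp [mul_assoc]

/-- The trace of right multiplication by a group element on the right ideal generated by an
idempotent. -/
lemma trace_restrict_mulRight {f : MonoidAlgebra ℂ G} (hf : f * f = f) (w : G)
    (h : ∀ x ∈ LinearMap.range (LinearMap.mulLeft ℂ f),
      LinearMap.mulRight ℂ (of ℂ G w) x ∈ LinearMap.range (LinearMap.mulLeft ℂ f)) :
    LinearMap.trace ℂ _ ((LinearMap.mulRight ℂ (of ℂ G w)).restrict h) =
      ∑ x, f.coeff (x * w⁻¹ * x⁻¹) := by
  have := LinearMap.trace_comp_comm' (R := ℂ) (LinearMap.range (LinearMap.mulLeft ℂ f)).subtype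
    ((LinearMap.mulLeft ℂ f).rangeRestrict ∘ₗ LinearMap.mulRight ℂ (of ℂ G w))
  rw [← trace_mulLeft_comp_mulRight]
  refine Eq.trans (congrArg _ ?_) this
  ext ⟨_, x, rfl⟩
  simp [← mul_assoc, hf]

lemma finrank_range_mulLeft {f : MonoidAlgebra ℂ G} (hf : f * f = f) :
    (Module.finrank ℂ (LinearMap.range (LinearMap.mulLeft ℂ f)) : ℂ) =
      Fintype.card G * f.coeff 1 := by
  have h1 : LinearMap.mulRight ℂ (of ℂ G 1) = LinearMap.id := by
    rw [map_one, LinearMap.mulRight_one]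
  have h := trace_mulLeft_comp_mulRight f 1
  have h2 : IsIdempotentElem (LinearMap.mulLeft ℂ f) := by
    ext x
    simp [← mul_assoc, hf]
  rw [h1, LinearMap.comp_id, (LinearMap.IsIdempotentElem.isProj_range _ h2).trace] at h
  simpa using h

end Trace

lemma cgen_apply {m : ℕ} (hm : m < n) (x : Fin n) :
    (cgen n (m + 1) x : ℕ) = if (x : ℕ) = 0 then m else if (x : ℕ) ≤ m then x - 1 else x := by
  induction m with
  | zero =>
    simp only [cgen, Nat.sub_self, zero_add, List.range_zero, List.reverse_nil, List.map_nil,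
      List.prod_nil, Perm.one_apply]
    split_ifs <;> omega
  | succ m ih =>
    have h : cgen n (m + 1 + 1) = sgen n (m + 1) * cgen n (m + 1) := by
      simp [cgen, List.range_succ]
    have ih := ih (by omega)
    rw [h, Perm.mul_apply, sgen, dif_pos (by omega)]
    simp only [swap_apply_def, Fin.ext_iff]
    split_ifs at ih ⊢ <;> (try simp only at *) <;> omega

lemma pow_cgen_apply {m : ℕ} (hm : m < n) {x : Fin n} (hx : (x : ℕ) ≤ m) {j : ℕ}
    (hj : j ≤ m + 1) :
    (((cgen n (m + 1)) ^ j) x : ℕ) = if j ≤ (x : ℕ) then x - j else x + m + 1 - j := by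
  induction j with
  | zero => simp
  | succ j ih =>
    have ih := ih (by omega)
    rw [pow_succ', Perm.mul_apply, cgen_apply hm]
    split_ifs at ih ⊢ <;> omega

lemma pow_cgen {m : ℕ} (hm : m < n) : (cgen n (m + 1)) ^ (m + 1) = 1 := by
  ext x
  by_cases hx : (x : ℕ) ≤ m
  · rw [pow_cgen_apply hm hx le_rfl, Perm.one_apply]
    split_ifs <;> omega
  · have h : cgen n (m + 1) x = x := by
      ext
      rw [cgen_apply hm]
      split_ifs <;> omega
    rw [Perm.pow_apply_eq_self_of_apply_eq_self h, Perm.one_apply]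

lemma bplus_zero (k : ℕ) : bplus n 0 k = if k = 0 then 1 else 0 := by
  simp [bplus, Polynomial.coeff_one]

lemma bplus_succ_zero (m : ℕ) : bplus n (m + 1) 0 = bplus n m 0 := by
  simp [bplus, List.range_succ, mul_sub, ← mul_assoc]

lemma bplus_succ_succ (m k : ℕ) :
    bplus n (m + 1) (k + 1) = bplus n m (k + 1) - bplus n m k * of ℂ _ (cgen n (m + 1)) := by
  simp [bplus, List.range_succ, mul_sub, ← mul_assoc, Polynomial.coeff_mul_X]

/-- The permutations of `{0, …, m - 1}` that decrease on the first `k` positions and increase on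
the others. -/
def valleys (n k m : ℕ) : Finset (Perm (Fin n)) :=
  univ.filter fun v => k ≤ m ∧ (∀ x : Fin n, m ≤ x → v x = x) ∧
    ∀ x y : Fin n, (x : ℕ) + 1 = y →
      ((y : ℕ) < k → v y < v x) ∧ (k ≤ (x : ℕ) → v x < v y)

lemma mem_valleys {k m : ℕ} {v : Perm (Fin n)} : v ∈ valleys n k m ↔
    k ≤ m ∧ (∀ x : Fin n, m ≤ x → v x = x) ∧ ∀ x y : Fin n, (x : ℕ) + 1 = y →
      ((y : ℕ) < k → v y < v x) ∧ (k ≤ (x : ℕ) → v x < v y) := by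
  simp [valleys]

lemma valleys_zero (m : ℕ) : valleys n 0 m = {1} := by
  ext v
  rw [mem_valleys, mem_singleton]
  constructor
  · exact fun h => perm_eq_one_of_adjacent fun x y hxy => (h.2.2 x y hxy).2 (Nat.zero_le _)
  · rintro rfl
    refine ⟨Nat.zero_le _, fun _ _ => rfl, fun x y hxy => ?_⟩
    rw [Perm.one_apply, Perm.one_apply, Fin.lt_def, Fin.lt_def]
    omega

lemma val_lt_of_fixes {v : Perm (Fin n)} {m : ℕ} (h : ∀ x : Fin n, m ≤ x → v x = x) {x : Fin n}
    (hx : (x : ℕ) < m) : (v x : ℕ) < m := by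
  by_contra h'
  have := v.injective (h (v x) (not_lt.1 h'))
  rw [this] at h'
  exact h' hx

lemma mul_cgen_mem_valleys {k m : ℕ} (hm : m < n) {u : Perm (Fin n)} :
    u * cgen n (m + 1) ∈ valleys n (k + 1) (m + 1) ∧ (u * cgen n (m + 1)) ⟨0, by omega⟩ = ⟨m, hm⟩ ↔
      u ∈ valleys n k m := by
  set v := u * cgen n (m + 1) with hv
  have h0 : v ⟨0, by omega⟩ = u ⟨m, hm⟩ := by
    rw [hv, Perm.mul_apply]
    congr 1
    ext
    simp [cgen_apply hm]
  have hs {x y : Fin n} (hxy : (x : ℕ) + 1 = y) (hy : (y : ℕ) ≤ m) : v y = u x := by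
    rw [hv, Perm.mul_apply]
    congr 1
    ext
    rw [cgen_apply hm]
    split_ifs <;> omega
  have hf {x : Fin n} (hx : m < x) : v x = u x := by
    rw [hv, Perm.mul_apply]
    congr 1
    ext
    rw [cgen_apply hm]
    split_ifs <;> omega
  rw [mem_valleys, mem_valleys, h0]
  constructor
  · rintro ⟨⟨h1, h2, h3⟩, h4⟩
    have hfix (x : Fin n) (hx : m ≤ x) : u x = x := by
      rcases hx.eq_or_lt with hx | hx
      · obtain rfl : x = ⟨m, hm⟩ := Fin.ext hx.symm
        exact h4
      · rw [← hf hx, h2 x hx]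
    refine ⟨by omega, hfix, fun x y hxy => ?_⟩
    rcases lt_or_ge (y : ℕ) m with hy | hy
    · have h5 := h3 y ⟨y + 1, by omega⟩ rfl
      rw [hs hxy hy.le, hs (x := y) rfl (by simp only; omega)] at h5
      simp only at h5
      exact ⟨fun h => h5.1 (by omega), fun h => h5.2 (by omega)⟩
    · rw [hfix y hy]
      refine ⟨fun h => by omega, fun _ => ?_⟩
      rcases lt_or_ge (x : ℕ) m with hx | hx
      · have := val_lt_of_fixes hfix hx
        rw [Fin.lt_def]
        omega
      · rw [hfix x hx, Fin.lt_def]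
        omega
  · rintro ⟨h1, h2, h3⟩
    refine ⟨⟨by omega, fun x hx => by rw [hf hx, h2 x (by omega)], fun x y hxy => ?_⟩, h2 _ le_rfl⟩
    rcases lt_or_ge m (y : ℕ) with hy | hy
    · rw [hf hy, h2 y hy.le]
      refine ⟨fun h => by omega, fun hk => ?_⟩
      rcases lt_or_ge m (x : ℕ) with hx | hx
      · rw [hf hx, h2 x hx.le, Fin.lt_def]
        omega
      · obtain ⟨x', hx'⟩ : ∃ x' : Fin n, (x' : ℕ) + 1 = x := ⟨⟨x - 1, by omega⟩, by simp only; omega⟩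
        have := val_lt_of_fixes h2 (x := x') (by omega)
        rw [hs hx' hx, Fin.lt_def]
        omega
    · rw [hs hxy hy]
      by_cases hx : (x : ℕ) = 0
      · rw [show x = ⟨0, by omega⟩ from Fin.ext hx]
        refine ⟨fun _ => ?_, fun h => by simp at h⟩
        have := val_lt_of_fixes h2 (x := ⟨0, by omega⟩) (by simp only at *; omega)
        rw [h0, h2 ⟨m, hm⟩ le_rfl, Fin.lt_def]
        exact this
      · obtain ⟨x', hx'⟩ : ∃ x' : Fin n, (x' : ℕ) + 1 = x := ⟨⟨x - 1, by omega⟩, by simp only; omega⟩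
        rw [hs hx' (by omega)]
        exact ⟨fun h => (h3 x' x hx').1 (by omega), fun h => (h3 x' x hx').2 (by omega)⟩

lemma mem_valleys_succ_of_apply_zero_ne {k m : ℕ} (hm : m < n) {v : Perm (Fin n)}
    (h0 : v ⟨0, by omega⟩ ≠ ⟨m, hm⟩) :
    v ∈ valleys n (k + 1) (m + 1) ↔ v ∈ valleys n (k + 1) m := by
  rw [mem_valleys, mem_valleys]
  constructor
  · rintro ⟨h1, h2, h3⟩
    obtain ⟨z, hz⟩ := v.surjective ⟨m, hm⟩
    have hzm : (z : ℕ) ≤ m := by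
      by_contra h
      rw [h2 z (by omega)] at hz
      simp [hz] at h
    have hz0 : (z : ℕ) ≠ 0 := fun h => h0 (by rw [← hz]; congr 1; exact Fin.ext h.symm)
    have hkz : k + 1 ≤ (z : ℕ) := by
      by_contra h
      have h4 := (h3 ⟨z - 1, by omega⟩ z (by simp only; omega)).1 (by omega)
      have h5 := val_lt_of_fixes h2 (x := ⟨z - 1, by omega⟩) (by simp only; omega)
      rw [hz, Fin.lt_def] at h4
      simp only at h4
      omega
    have hzm' : z = ⟨m, hm⟩ := by
      by_contra h
      rw [Fin.ext_iff] at h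
      simp only at h
      have h4 := (h3 z ⟨z + 1, by omega⟩ rfl).2 hkz
      have h5 := val_lt_of_fixes h2 (x := ⟨z + 1, by omega⟩) (by simp only; omega)
      rw [hz, Fin.lt_def] at h4
      simp only at h4
      omega
    subst hzm'
    refine ⟨hkz, fun x hx => ?_, h3⟩
    rcases hx.eq_or_lt with hx | hx
    · obtain rfl : x = ⟨m, hm⟩ := Fin.ext hx.symm
      exact hz
    · exact h2 x hx
  · rintro ⟨h1, h2, h3⟩
    exact ⟨by omega, fun x hx => h2 x (by omega), h3⟩

lemma apply_zero_ne_of_mem_valleys {k m : ℕ} (hm : m < n) {v : Perm (Fin n)}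
    (hv : v ∈ valleys n (k + 1) m) : v ⟨0, by omega⟩ ≠ ⟨m, hm⟩ := by
  rw [mem_valleys] at hv
  intro h
  have := val_lt_of_fixes hv.2.1 (x := ⟨0, by omega⟩) (by simp only; omega)
  rw [h] at this
  simp at this

lemma bplus_eq_sum {m : ℕ} (hm : m ≤ n) (k : ℕ) :
    bplus n m k = (-1 : ℂ) ^ k • ∑ v ∈ valleys n k m, of ℂ _ v := by
  induction m generalizing k with
  | zero =>
    rw [bplus_zero]
    cases k with
    | zero => simp only [if_true, valleys_zero, sum_singleton, map_one, pow_zero, one_smul]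
    | succ k =>
      have : valleys n (k + 1) 0 = ∅ := by ext; simp [mem_valleys]
      simp [this]
  | succ m ih =>
    cases k with
    | zero => rw [bplus_succ_zero, ih (by omega), valleys_zero, valleys_zero]
    | succ k =>
      have hc : valleys n (k + 1) (m + 1) = valleys n (k + 1) m ∪
          (valleys n k m).map (Equiv.mulRight (cgen n (m + 1))).toEmbedding := by
        ext v
        rw [mem_union, mem_map_equiv]
        obtain ⟨u, rfl⟩ : ∃ u, v = u * cgen n (m + 1) := ⟨v * (cgen n (m + 1))⁻¹, by simp⟩
        have h1 : (Equiv.mulRight (cgen n (m + 1))).symm (u * cgen n (m + 1)) = u := by simp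
        rw [h1]
        by_cases h : (u * cgen n (m + 1)) ⟨0, by omega⟩ = ⟨m, by omega⟩
        · rw [← mul_cgen_mem_valleys (u := u) (by omega : m < n)]
          have h2 := fun h' => apply_zero_ne_of_mem_valleys (k := k) (by omega : m < n) h' h
          tauto
        · rw [mem_valleys_succ_of_apply_zero_ne (by omega) h,
            ← mul_cgen_mem_valleys (u := u) (by omega : m < n)]
          tauto
      have hd : Disjoint (valleys n (k + 1) m)
          ((valleys n k m).map (Equiv.mulRight (cgen n (m + 1))).toEmbedding) := by
        rw [disjoint_left]
        intro v hv h
        obtain ⟨u, hu, rfl⟩ := mem_map.1 h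
        exact apply_zero_ne_of_mem_valleys (by omega) hv
          ((mul_cgen_mem_valleys (by omega : m < n)).2 hu).2
      rw [bplus_succ_succ, ih (by omega), ih (by omega), hc, sum_union hd, sum_map, smul_add,
        smul_mul_assoc, sum_mul, pow_succ, mul_neg_one, neg_smul, neg_smul,
        sub_eq_add_neg]
      simp [single_mul_single]

lemma bplus_eq_zero {m k : ℕ} (hm : m ≤ n) (h : m < k) : bplus n m k = 0 := by
  have : valleys n k m = ∅ := by ext; simp [mem_valleys]; omega
  simp [bplus_eq_sum hm, this]

lemma sum_signed_minCoset {D U : Finset (Perm (Fin n))} (hD : D ⊆ Simples n) (hU : U ⊆ Simples n)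
    (v : Perm (Fin n)) :
    ∑ T ∈ D.powerset, (-1 : ℂ) ^ T.card * (if v ∈ minCoset n Set.univ (T ∪ U) then 1 else 0) =
      if (∀ x y : Fin n, (x : ℕ) + 1 = y → (swap x y ∈ D → v y < v x) ∧
        (swap x y ∈ U → v x < v y)) then 1 else 0 := by
  set A := D.filter fun g => v ∈ minCoset n Set.univ {g} with hA
  have hmemA {x y : Fin n} (hxy : (x : ℕ) + 1 = y) :
      swap x y ∈ A ↔ swap x y ∈ D ∧ v x < v y := by
    rw [hA, mem_filter]
    refine and_congr_right fun h => ?_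
    rw [mem_minCoset (singleton_subset_iff.2 (hD h))]
    constructor
    · exact fun h => h x y hxy (mem_singleton_self _)
    · intro h x' y' hxy' h'
      obtain ⟨rfl, rfl⟩ := swap_adjacent_inj hxy hxy' (mem_singleton.1 h').symm
      exact h
  by_cases hv : v ∈ minCoset n Set.univ U
  · have h1 (T : Finset (Perm (Fin n))) (hT : T ∈ D.powerset) :
        v ∈ minCoset n Set.univ (T ∪ U) ↔ T ∈ A.powerset := by
      rw [mem_powerset] at hT ⊢
      rw [mem_minCoset hU] at hv
      rw [mem_minCoset (union_subset (hT.trans hD) hU)]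
      constructor
      · intro h g hg
        obtain ⟨x, y, hxy, rfl⟩ := mem_Simples.1 (hD (hT hg))
        exact (hmemA hxy).2 ⟨hT hg, h x y hxy (mem_union_left _ hg)⟩
      · intro h x y hxy hs
        rcases mem_union.1 hs with hs | hs
        · exact ((hmemA hxy).1 (h hs)).2
        · exact hv x y hxy hs
    have h2 : ∑ T ∈ D.powerset, (-1 : ℂ) ^ T.card *
        (if v ∈ minCoset n Set.univ (T ∪ U) then 1 else 0) = ∑ T ∈ A.powerset, (-1 : ℂ) ^ T.card := by
      rw [← sum_subset (powerset_mono.2 (filter_subset _ _) : A.powerset ⊆ D.powerset)]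
      · refine sum_congr rfl fun T hT => ?_
        rw [if_pos ((h1 T (powerset_mono.2 (filter_subset _ _) hT)).2 hT), mul_one]
      · intro T hT hT'
        rw [if_neg (fun h => hT' ((h1 T hT).1 h)), mul_zero]
    have h3 : ∑ T ∈ A.powerset, (-1 : ℂ) ^ T.card = if A = ∅ then 1 else 0 := by
      have := congrArg (Int.cast (R := ℂ)) (sum_powerset_neg_one_pow_card (x := A))
      push_cast at this
      exact this
    rw [h2, h3]
    refine if_congr ?_ rfl rfl
    rw [mem_minCoset hU] at hv
    constructor
    · intro h x y hxy
      refine ⟨fun hs => ?_, hv x y hxy⟩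
      have h4 : ¬ v x < v y := fun h' => by
        have := (hmemA hxy).2 ⟨hs, h'⟩
        simp [h] at this
      refine lt_of_le_of_ne (not_lt.1 h4) fun h5 => ?_
      rw [v.injective h5] at hxy
      omega
    · intro h
      rw [eq_empty_iff_forall_notMem]
      intro g hg
      obtain ⟨x, y, hxy, rfl⟩ := mem_Simples.1 (hD (mem_of_mem_filter _ hg))
      obtain ⟨h4, h5⟩ := (hmemA hxy).1 hg
      exact absurd h5 ((h x y hxy).1 h4).not_gt
  · rw [if_neg, sum_eq_zero]
    · intro T hT
      rw [if_neg, mul_zero]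
      intro h
      rw [mem_minCoset (union_subset ((mem_powerset.1 hT).trans hD) hU)] at h
      exact hv ((mem_minCoset hU).2 fun x y hxy hs => h x y hxy (mem_union_right _ hs))
    · exact fun h => hv ((mem_minCoset hU).2 fun x y hxy => (h x y hxy).2)

lemma eulerian_mul_sum_valleys {k : ℕ} (hk : 0 < k) (hkn : k < n) :
    eulerian n * ∑ v ∈ valleys n k n, of ℂ _ v = 0 := by
  set D := (Simples n).filter fun g => ∃ x y : Fin n, (x : ℕ) + 1 = y ∧ (y : ℕ) < k ∧ g = swap x y
    with hD
  set U := (Simples n).filter fun g => ∃ x y : Fin n, (x : ℕ) + 1 = y ∧ k ≤ (x : ℕ) ∧ g = swap x y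
    with hU
  have hDS : D ⊆ Simples n := filter_subset _ _
  have hUS : U ⊆ Simples n := filter_subset _ _
  have hmemD {x y : Fin n} (hxy : (x : ℕ) + 1 = y) : swap x y ∈ D ↔ (y : ℕ) < k := by
    rw [hD, mem_filter]
    constructor
    · rintro ⟨-, x', y', hxy', h, he⟩
      obtain ⟨rfl, rfl⟩ := swap_adjacent_inj hxy hxy' he
      exact h
    · exact fun h => ⟨mem_Simples.2 ⟨x, y, hxy, rfl⟩, x, y, hxy, h, rfl⟩
  have hmemU {x y : Fin n} (hxy : (x : ℕ) + 1 = y) : swap x y ∈ U ↔ k ≤ (x : ℕ) := by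
    rw [hU, mem_filter]
    constructor
    · rintro ⟨-, x', y', hxy', h, he⟩
      obtain ⟨rfl, rfl⟩ := swap_adjacent_inj hxy hxy' he
      exact h
    · exact fun h => ⟨mem_Simples.2 ⟨x, y, hxy, rfl⟩, x, y, hxy, h, rfl⟩
  have h1 : ∑ v ∈ valleys n k n, of ℂ _ v =
      ∑ T ∈ D.powerset, (-1 : ℂ) ^ T.card • xRel n Set.univ (T ∪ U) := by
    ext v
    simp only [coeff_sum, Finsupp.finsetSum_apply, coeff_smul, Finsupp.smul_apply, coeff_xRel,
      smul_eq_mul]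
    rw [sum_signed_minCoset hDS hUS]
    have h2 : v ∈ valleys n k n ↔ ∀ x y : Fin n, (x : ℕ) + 1 = y →
        (swap x y ∈ D → v y < v x) ∧ (swap x y ∈ U → v x < v y) := by
      rw [mem_valleys]
      constructor
      · rintro ⟨-, -, h⟩ x y hxy
        rw [hmemD hxy, hmemU hxy]
        exact h x y hxy
      · refine fun h => ⟨hkn.le, fun x hx => by omega, fun x y hxy => ?_⟩
        rw [← hmemD hxy, ← hmemU hxy]
        exact h x y hxy
    simp [← h2, Finsupp.single_apply]
  rw [h1, mul_sum]
  refine sum_eq_zero fun T hT => ?_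
  rw [mem_powerset] at hT
  rw [mul_smul_comm, eulerian_mul_xRel (by omega), smul_zero]
  refine (union_subset (hT.trans hDS) hUS).ssubset_of_ne fun h => ?_
  have hxy : ((⟨k - 1, by omega⟩ : Fin n) : ℕ) + 1 = (⟨k, hkn⟩ : Fin n) := by simp only; omega
  have h2 := mem_Simples.2 ⟨_, _, hxy, rfl⟩
  rw [← h, mem_union, hmemU hxy] at h2
  rcases h2 with h2 | h2
  · have := (hmemD hxy).1 (hT h2)
    simp at this
  · simp only at h2
    omega

lemma eulerian_mul_bplus {m : ℕ} (hm : m + 1 = n) {k : ℕ} (hk : k ≤ m) :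
    eulerian n * bplus n m k = eulerian n * of ℂ _ (cgen n (m + 1)) ^ k := by
  induction k with
  | zero => rw [bplus_eq_sum (by omega), valleys_zero, sum_singleton, map_one]; simp
  | succ k ih =>
    have h1 := bplus_succ_succ (n := n) m k
    rw [hm, bplus_eq_sum le_rfl] at h1
    have h2 := congrArg (eulerian n * ·) h1
    simp only [mul_smul_comm, eulerian_mul_sum_valleys (Nat.succ_pos k) (by omega : k + 1 < n),
      smul_zero, mul_sub, ← mul_assoc] at h2
    rw [pow_succ, ← mul_assoc, ← ih (by omega), hm]
    exact (sub_eq_zero.1 h2.symm)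

/-- The value of the generating polynomial of the `bplus n m k` at a scalar. -/
def bplusEval (n m : ℕ) (z : ℂ) : MonoidAlgebra ℂ (Perm (Fin n)) :=
  ∑ k ∈ range (m + 1), z ^ k • bplus n m k

lemma bplusEval_succ {m : ℕ} (hm : m < n) (z : ℂ) :
    bplusEval n (m + 1) z = bplusEval n m z * (1 - z • of ℂ _ (cgen n (m + 1))) := by
  have h1 : bplusEval n m z = ∑ k ∈ range (m + 1), z ^ (k + 1) • bplus n m (k + 1) +
      bplus n m 0 := by
    rw [bplusEval, sum_range_succ', sum_range_succ, bplus_eq_zero hm.le (Nat.lt_succ_self m)]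
    simp
  rw [mul_sub, mul_one]
  conv_rhs => rw [h1]; arg 2; rw [← h1]
  rw [bplusEval, sum_range_succ', bplusEval, sum_mul]
  simp only [bplus_succ_succ, bplus_succ_zero, smul_sub, sum_sub_distrib, pow_zero, one_smul,
    mul_smul_comm, smul_mul_assoc, smul_smul, pow_succ']
  abel

lemma isUnit_one_sub_smul {A : Type*} [Ring A] [Algebra ℂ A] {g : A} {z : ℂ} {i : ℕ}
    (hg : g ^ i = 1) (hz : z ^ i ≠ 1) : IsUnit (1 - z • g) := by
  have h : (1 - z • g) * ∑ j ∈ range i, (z • g) ^ j = algebraMap ℂ A (1 - z ^ i) := by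
    rw [mul_neg_geom_sum, smul_pow, hg, map_sub, map_one, Algebra.algebraMap_eq_smul_one]
  have hu : IsUnit (algebraMap ℂ A (1 - z ^ i)) :=
    (IsUnit.mk0 _ (sub_ne_zero.2 hz.symm)).map _
  rw [← h] at hu
  have hc : Commute (1 - z • g) (∑ j ∈ range i, (z • g) ^ j) :=
    (mul_neg_geom_sum _ _).trans (geom_sum_mul_neg _ _).symm
  exact (hc.isUnit_mul_iff.1 hu).1

lemma isUnit_bplusEval {m : ℕ} (hm : m < n) {z : ℂ} (hz : ∀ i, 0 < i → i < n → z ^ i ≠ 1) :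
    IsUnit (bplusEval n m z) := by
  induction m with
  | zero => simp [bplusEval, bplus_zero]
  | succ m ih =>
    rw [bplusEval_succ (by omega)]
    refine (ih (by omega)).mul (isUnit_one_sub_smul (i := m + 1) ?_ (hz _ (by omega) hm))
    rw [← map_pow, pow_cgen (by omega), map_one]

/-- If `e` and `f` are idempotents with the same coefficient at the identity and `e * f` is
`e` times a unit, then left multiplication by `e` is an isomorphism between the right ideals
they generate. -/
lemma exists_equiv_range_mulLeft {G : Type*} [Group G] [Fintype G] {e f u : MonoidAlgebra ℂ G}
    (he : e * e = e) (hf : f * f = f) (h1 : e.coeff 1 = f.coeff 1) (hu : IsUnit u)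
    (hefu : e * f = e * u) :
    ∃ T : LinearMap.range (LinearMap.mulLeft ℂ f) ≃ₗ[ℂ] LinearMap.range (LinearMap.mulLeft ℂ e),
      ∀ x, (T x : MonoidAlgebra ℂ G) = e * x := by
  have hr : Module.finrank ℂ (LinearMap.range (LinearMap.mulLeft ℂ f)) =
      Module.finrank ℂ (LinearMap.range (LinearMap.mulLeft ℂ e)) := by
    have := (finrank_range_mulLeft hf).trans
      ((congrArg _ h1.symm).trans (finrank_range_mulLeft he).symm)
    exact_mod_cast this
  let T := (LinearMap.mulLeft ℂ e).restrict (p := LinearMap.range (LinearMap.mulLeft ℂ f))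
    (q := LinearMap.range (LinearMap.mulLeft ℂ e)) fun x _ => ⟨x, rfl⟩
  have hs : Function.Surjective T := by
    rintro ⟨_, y, rfl⟩
    obtain ⟨v, rfl⟩ := hu
    refine ⟨⟨f * (↑v⁻¹ * y), _, rfl⟩, Subtype.ext ?_⟩
    change e * (f * (↑v⁻¹ * y)) = e * y
    rw [← mul_assoc, hefu, mul_assoc, Units.mul_inv_cancel_left]
  have hi : Function.Injective T :=
    (LinearMap.injective_iff_surjective_of_finrank_eq_finrank hr).2 hs
  exact ⟨LinearEquiv.ofBijective T ⟨hi, hs⟩, fun x => rfl⟩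

lemma bijOn_of_equiv_range_mulLeft {G : Type*} [Group G] {e f : MonoidAlgebra ℂ G}
    (T : LinearMap.range (LinearMap.mulLeft ℂ f) ≃ₗ[ℂ] LinearMap.range (LinearMap.mulLeft ℂ e))
    (hT : ∀ x, (T x : MonoidAlgebra ℂ G) = e * x) :
    Set.BijOn (fun x => e * x) {y | ∃ x, y = f * x} {y | ∃ x, y = e * x} := by
  refine ⟨fun x _ => ⟨x, rfl⟩, ?_, ?_⟩
  · rintro x ⟨a, ha⟩ y ⟨b, hb⟩ hxy
    have hx : x ∈ LinearMap.range (LinearMap.mulLeft ℂ f) := ⟨a, ha.symm⟩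
    have hy : y ∈ LinearMap.range (LinearMap.mulLeft ℂ f) := ⟨b, hb.symm⟩
    have h : T ⟨x, hx⟩ = T ⟨y, hy⟩ := Subtype.ext (by rw [hT, hT]; exact hxy)
    exact congrArg Subtype.val (T.injective h)
  · rintro y ⟨b, hb⟩
    have hy : y ∈ LinearMap.range (LinearMap.mulLeft ℂ e) := ⟨b, hb.symm⟩
    obtain ⟨x, hx⟩ := T.surjective ⟨y, hy⟩
    obtain ⟨a, ha⟩ := x.2
    exact ⟨x, ⟨a, ha.symm⟩, (hT x).symm.trans (congrArg Subtype.val hx)⟩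

lemma trace_restrict_mulRight_congr {G : Type*} [Group G] {e f : MonoidAlgebra ℂ G}
    (T : LinearMap.range (LinearMap.mulLeft ℂ f) ≃ₗ[ℂ] LinearMap.range (LinearMap.mulLeft ℂ e))
    (hT : ∀ x, (T x : MonoidAlgebra ℂ G) = e * x) (w : G)
    (hf : ∀ x ∈ LinearMap.range (LinearMap.mulLeft ℂ f),
      LinearMap.mulRight ℂ (of ℂ G w) x ∈ LinearMap.range (LinearMap.mulLeft ℂ f))
    (he : ∀ x ∈ LinearMap.range (LinearMap.mulLeft ℂ e),
      LinearMap.mulRight ℂ (of ℂ G w) x ∈ LinearMap.range (LinearMap.mulLeft ℂ e)) :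
    LinearMap.trace ℂ _ ((LinearMap.mulRight ℂ (of ℂ G w)).restrict hf) =
      LinearMap.trace ℂ _ ((LinearMap.mulRight ℂ (of ℂ G w)).restrict he) := by
  rw [← LinearMap.trace_conj' _ T]
  refine congrArg _ (LinearMap.ext fun x => Subtype.ext ?_)
  obtain ⟨x, rfl⟩ := T.surjective x
  rw [LinearEquiv.conj_apply_apply, LinearEquiv.symm_apply_apply, hT]
  change e * (x * of ℂ G w) = T x * of ℂ G w
  rw [hT, mul_assoc]

lemma exists_pow_cgen_apply_zero {m : ℕ} (x : Fin (m + 1)) :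
    ∃ k < m + 1, (cgen (m + 1) (m + 1) ^ k) 0 = x := by
  have hx := x.isLt
  rcases Nat.eq_zero_or_pos (x : ℕ) with h | h
  · exact ⟨0, m.succ_pos, Fin.ext (by simp [h])⟩
  · refine ⟨m + 1 - x, by omega, Fin.ext ?_⟩
    rw [pow_cgen_apply m.lt_succ_self (by simp) (by omega), if_neg (by simp; omega)]
    simp
    omega

lemma mem_centralizer_cgen {m : ℕ} {g : Perm (Fin (m + 1))} :
    g ∈ Subgroup.centralizer {cgen (m + 1) (m + 1)} ↔
      ∃ k < m + 1, cgen (m + 1) (m + 1) ^ k = g := by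
  rw [Subgroup.mem_centralizer_singleton_iff]
  constructor
  · intro h
    have hc : Commute g (cgen (m + 1) (m + 1)) := h
    obtain ⟨k, hk, h0⟩ := exists_pow_cgen_apply_zero (g 0)
    refine ⟨k, hk, Equiv.ext fun x => ?_⟩
    obtain ⟨i, -, rfl⟩ := exists_pow_cgen_apply_zero x
    rw [← Perm.mul_apply, ← Perm.mul_apply, ← pow_add, add_comm k i, pow_add, Perm.mul_apply, h0,
      (hc.pow_right i).eq, Perm.mul_apply]
  · rintro ⟨k, -, rfl⟩
    exact ((Commute.refl _).pow_left k).eq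

lemma orderOf_cgen (m : ℕ) : orderOf (cgen (m + 1) (m + 1)) = m + 1 := by
  refine (orderOf_eq_iff m.succ_pos).2 ⟨pow_cgen m.lt_succ_self, fun k hk h0 h => ?_⟩
  have h2 := pow_cgen_apply (n := m + 1) m.lt_succ_self (x := 0) (by simp) hk.le
  rw [h, if_neg (by simp; omega)] at h2
  simp at h2
  omega

lemma card_centralizer_cgen (m : ℕ) :
    Nat.card (Subgroup.centralizer {cgen (m + 1) (m + 1)}) = m + 1 := by
  have h : Subgroup.centralizer {cgen (m + 1) (m + 1)} =
      Subgroup.zpowers (cgen (m + 1) (m + 1)) := by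
    ext g
    rw [mem_centralizer_cgen]
    constructor
    · rintro ⟨k, -, rfl⟩
      exact Subgroup.npow_mem_zpowers _ k
    · rw [← mem_powers_iff_mem_zpowers, mem_powers_iff_mem_range_orderOf, orderOf_cgen]
      simp
  rw [h, Nat.card_zpowers, orderOf_cgen]

/-- The average of the first `n` powers of `y`. -/
def powAvg {A : Type*} [Ring A] [Algebra ℂ A] (y : A) (n : ℕ) : A :=
  (n : ℂ)⁻¹ • ∑ k ∈ range n, y ^ k

lemma powAvg_mul_self {A : Type*} [Ring A] [Algebra ℂ A] {y : A} {n : ℕ} (hn : n ≠ 0)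
    (hy : y ^ n = 1) : powAvg y n * powAvg y n = powAvg y n := by
  have h1 : y * powAvg y n = powAvg y n := by
    have := mul_neg_geom_sum y n
    rw [hy, sub_self, sub_mul, one_mul, sub_eq_zero] at this
    rw [powAvg, mul_smul_comm, ← this]
  have h2 (k : ℕ) : y ^ k * powAvg y n = powAvg y n := by
    induction k with
    | zero => rw [pow_zero, one_mul]
    | succ k ih => rw [pow_succ, mul_assoc, h1, ih]
  conv_lhs => arg 1; rw [powAvg]
  rw [smul_mul_assoc, sum_mul, sum_congr rfl fun k _ => h2 k, sum_const, card_range,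
    ← Nat.cast_smul_eq_nsmul ℂ, smul_smul, inv_mul_cancel₀ (by exact_mod_cast hn), one_smul]

lemma powAvg_of_mul_eq_one {A : Type*} [Ring A] [Algebra ℂ A] {y z : A} {n : ℕ}
    (hy : y ^ n = 1) (hyz : y * z = 1) (hzy : z * y = 1) : powAvg z n = powAvg y n := by
  have hc : Commute y z := hyz.trans hzy.symm
  have h1 : ∑ k ∈ range n, z ^ k = ∑ k ∈ range n, y ^ (k + 1) := by
    rw [← sum_range_reflect]
    refine sum_congr rfl fun k hk => ?_
    rw [mem_range] at hk
    have h2 : y ^ (n - 1 - k) * z ^ (n - 1 - k) = 1 := by rw [← hc.mul_pow, hyz, one_pow]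
    calc z ^ (n - 1 - k) = y ^ n * z ^ (n - 1 - k) := by rw [hy, one_mul]
      _ = y ^ (k + 1) * (y ^ (n - 1 - k) * z ^ (n - 1 - k)) := by
        rw [← mul_assoc, ← pow_add]; congr 2; omega
      _ = y ^ (k + 1) := by rw [h2, mul_one]
  have h3 : ∑ k ∈ range n, y ^ (k + 1) = ∑ k ∈ range n, y ^ k := by
    have := (sum_range_succ' (fun k => y ^ k) n).symm.trans (sum_range_succ (fun k => y ^ k) n)
    rwa [hy, pow_zero, add_left_inj] at this
  rw [powAvg, powAvg, h1, h3]

lemma powAvg_coeff {G : Type*} [Group G] (z : ℂ) (c g : G) (n : ℕ) :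
    (powAvg (z • of ℂ G c) n).coeff g =
      (n : ℂ)⁻¹ * ∑ k ∈ range n, if c ^ k = g then z ^ k else 0 := by
  simp [powAvg, MonoidAlgebra.single_pow, Finsupp.single_apply]

/-- The coefficients of an average of powers of the inverse long cycle are supported on its
centralizer. -/
lemma powAvg_cgen_coeff {m : ℕ} {z : ℂ} {φ : Perm (Fin (m + 1)) → ℂ}
    (hφ : ∀ k : ℕ, φ (cgen (m + 1) (m + 1) ^ k) = z ^ k) (g : Perm (Fin (m + 1))) :
    (powAvg (z • of ℂ _ (cgen (m + 1) (m + 1))⁻¹) (m + 1)).coeff g⁻¹ = ((m + 1 : ℕ) : ℂ)⁻¹ *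
      if g ∈ Subgroup.centralizer {cgen (m + 1) (m + 1)} then φ g else 0 := by
  simp only [powAvg_coeff, inv_pow, inv_inj]
  congr 1
  split_ifs with hg
  · obtain ⟨k, hk, rfl⟩ := mem_centralizer_cgen.1 hg
    rw [sum_eq_single_of_mem k (mem_range.2 hk), if_pos rfl, hφ]
    intro i hi hik
    rw [mem_range, ← orderOf_cgen m] at hi
    rw [← orderOf_cgen m] at hk
    exact if_neg fun h => hik (pow_injOn_Iio_orderOf hi hk h)
  · exact sum_eq_zero fun k hk =>
      if_neg fun h => hg (mem_centralizer_cgen.2 ⟨k, mem_range.1 hk, h⟩)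

end

/-- Theorem 5.1(a): with `c = c_n`, `ζ = e^{2πi/n}` and
`f⁺ = (1/n) ∑_{k} ζ^{−k} c^{−k}`, the map `x ↦ e_n x` is an isomorphism of right
`ℂW`-modules `f⁺ℂW → E_n`; consequently the character of `W = S_n` on
`E_n = e_n ℂW` is the induced character `Ind_{Z_W(c)}^W(φ)`, where `Z_W(c) = ⟨c⟩`
and `φ` is the linear character of `⟨c⟩` with `φ(c⁻¹) = ζ` (computed here by the
usual formula for an induced character). -/
theorem stmt15 (hn : 2 ≤ n)
    (e : Finset (Equiv.Perm (Fin n)) → MonoidAlgebra ℂ (Equiv.Perm (Fin n)))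
    (he : IsBBHT n Set.univ (Simples n) e)
    (φ : Equiv.Perm (Fin n) → ℂ)
    (hφ : ∀ j : ℤ, φ ((cgen n n) ^ j)
      = (Complex.exp (2 * (Real.pi : ℂ) * Complex.I / (n : ℂ))) ^ (-j)) :
    let en := e (Simples n)
    let c := cgen n n
    let ζ : ℂ := Complex.exp (2 * (Real.pi : ℂ) * Complex.I / (n : ℂ))
    let fplus : MonoidAlgebra ℂ (Equiv.Perm (Fin n)) :=
      ((n : ℂ))⁻¹ • ∑ k ∈ Finset.range n, (ζ⁻¹) ^ k • of ℂ (Equiv.Perm (Fin n)) ((c⁻¹) ^ k)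
    let Z : Subgroup (Equiv.Perm (Fin n)) := Subgroup.centralizer {c}
    let En : Submodule ℂ (MonoidAlgebra ℂ (Equiv.Perm (Fin n))) :=
      LinearMap.range (LinearMap.mulLeft ℂ en)
    Set.BijOn (fun x => en * x)
      {y | ∃ x : MonoidAlgebra ℂ (Equiv.Perm (Fin n)), y = fplus * x}
      {y | ∃ x : MonoidAlgebra ℂ (Equiv.Perm (Fin n)), y = en * x} ∧
    ∀ w : Equiv.Perm (Fin n),
      LinearMap.trace ℂ En
        ((LinearMap.mulRight ℂ (of ℂ (Equiv.Perm (Fin n)) w)).restrict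
          (p := En) (q := En)
          (fun x hx => by
            obtain ⟨y, rfl⟩ := hx
            exact ⟨y * of ℂ (Equiv.Perm (Fin n)) w, by
              simp [LinearMap.mulLeft_apply, LinearMap.mulRight_apply, mul_assoc]⟩))
      = ((Nat.card Z : ℂ))⁻¹ *
          ∑ x : Equiv.Perm (Fin n),
            (if x * w * x⁻¹ ∈ Z then φ (x * w * x⁻¹) else 0) := by
  intro en c ζ fplus Z En
  obtain ⟨m, rfl⟩ : ∃ m, n = m + 1 := ⟨n - 1, by omega⟩
  have hζ : IsPrimitiveRoot ζ (m + 1) := Complex.isPrimitiveRoot_exp (m + 1) m.succ_ne_zero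
  have hζ0 : ζ ≠ 0 := hζ.ne_zero m.succ_ne_zero
  have hen : en = eulerian (m + 1) := eq_eulerian m.succ_pos he
  have hc : c ^ (m + 1) = 1 := pow_cgen m.lt_succ_self
  have hf : fplus = powAvg (ζ⁻¹ • of ℂ (Perm (Fin (m + 1))) c⁻¹) (m + 1) := by
    simp only [fplus, powAvg, smul_pow, map_pow]
  have hcoeff := powAvg_cgen_coeff (z := ζ⁻¹) (φ := φ) fun k => by
    rw [inv_pow, ← zpow_natCast ζ, ← zpow_neg, ← hφ, zpow_natCast]
  rw [← hf] at hcoeff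
  have hff : fplus * fplus = fplus := by
    rw [hf]
    refine powAvg_mul_self m.succ_ne_zero ?_
    rw [smul_pow, inv_pow, hζ.pow_eq_one, ← map_pow, inv_pow, hc, inv_one, inv_one, map_one,
      one_smul]
  have hee : en * en = en := hen ▸ eulerian_mul_self m.succ_pos
  have h1 : en.coeff 1 = fplus.coeff 1 := by
    have hφ1 : φ 1 = 1 := by simpa using hφ 0
    rw [hen, coeff_eulerian_one m.succ_pos, ← inv_one, hcoeff, if_pos (one_mem _), hφ1, mul_one]
  have hf' : fplus = powAvg (ζ • of ℂ (Perm (Fin (m + 1))) c) (m + 1) := by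
    rw [hf]
    apply powAvg_of_mul_eq_one
    · rw [smul_pow, hζ.pow_eq_one, ← map_pow, hc, map_one, one_smul]
    · rw [smul_mul_smul_comm, mul_inv_cancel₀ hζ0, ← map_mul, mul_inv_cancel, map_one, one_smul]
    · rw [smul_mul_smul_comm, inv_mul_cancel₀ hζ0, ← map_mul, inv_mul_cancel, map_one, one_smul]
  have hu : IsUnit (((m + 1 : ℕ) : ℂ)⁻¹ • bplusEval (m + 1) m ζ) :=
    (isUnit_bplusEval m.lt_succ_self fun i hi hin => hζ.pow_ne_one_of_pos_of_lt hi.ne' hin).smul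
      (Units.mk0 ((m + 1 : ℕ) : ℂ)⁻¹ (inv_ne_zero (by exact_mod_cast m.succ_ne_zero)))
  have hefu : en * fplus = en * (((m + 1 : ℕ) : ℂ)⁻¹ • bplusEval (m + 1) m ζ) := by
    rw [hf', hen, powAvg, bplusEval, mul_smul_comm, mul_smul_comm, mul_sum, mul_sum]
    congr 1
    refine sum_congr rfl fun k hk => ?_
    rw [mem_range, Nat.lt_succ_iff] at hk
    rw [smul_pow, mul_smul_comm, mul_smul_comm, eulerian_mul_bplus rfl hk]
  obtain ⟨T, hT⟩ := exists_equiv_range_mulLeft hee hff h1 hu hefu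
  refine ⟨bijOn_of_equiv_range_mulLeft T hT, fun w => ?_⟩
  have hw : ∀ x ∈ LinearMap.range (LinearMap.mulLeft ℂ fplus),
      LinearMap.mulRight ℂ (of ℂ (Perm (Fin (m + 1))) w) x ∈
        LinearMap.range (LinearMap.mulLeft ℂ fplus) := by
    rintro _ ⟨y, rfl⟩
    exact ⟨y * of ℂ _ w, (mul_assoc _ _ _).symm⟩
  refine (trace_restrict_mulRight_congr T hT w hw _).symm.trans
    ((trace_restrict_mulRight hff w hw).trans ?_)
  rw [card_centralizer_cgen, mul_sum]
  refine sum_congr rfl fun x _ => ?_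
  rw [← hcoeff]
  simp only [mul_inv_rev, inv_inv, mul_assoc]

end DPRSym
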